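/- Let p be a prime, let 2 ≤ q ≤ p and let n ≥ 1. If q = 2 or 2q > p, then secat(Map_q(ℤ_p, ℝⁿ) → Map_q(ℤ_p, ℝⁿ)/ℤ_p) = (n-1)(p-1) + q - 1, where ℤ_p = ℤ/pℤ acts freely on Map_q(ℤ_p, ℝⁿ) by (g•φ)(h) = φ(g⁻¹h). -/

import Mathlib

/-- `Map_q(G,Y)`: functions `G → Y` that are non-constant on every `q`-element subset of `G`. -/
def MapQ (G Y : Type*) (q : ℕ) : Set (G → Y) :=
  {φ | ∀ S : Finset G, S.card = q → ¬∃ y : Y, ∀ g ∈ S, φ g = y}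

theorem MapQ.smul_mem {G Y : Type*} [Group G] {q : ℕ} (g : G) {φ : G → Y}
    (hφ : φ ∈ MapQ G Y q) : (fun h => φ (g⁻¹ * h)) ∈ MapQ G Y q := by
  classical
  rintro S hS ⟨y, hy⟩
  refine hφ (S.image (fun h => g⁻¹ * h)) ?_ ⟨y, ?_⟩
  · rwa [Finset.card_image_of_injective _ (mul_right_injective g⁻¹)]
  · rintro a ha
    obtain ⟨b, hb, rfl⟩ := Finset.mem_image.mp ha
    exact hy b hb

/-- The left `G`-action on `Map_q(G,Y)` given by `(g • φ) h = φ (g⁻¹ * h)`. -/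
instance MapQ.instSMul {G Y : Type*} [Group G] {q : ℕ} : SMul G (MapQ G Y q) :=
  ⟨fun g φ => ⟨fun h => (φ : G → Y) (g⁻¹ * h), MapQ.smul_mem g φ.2⟩⟩

instance MapQ.instMulAction {G Y : Type*} [Group G] {q : ℕ} :
    MulAction G (MapQ G Y q) where
  one_smul φ := Subtype.ext <| funext fun h => by
    show (φ : G → Y) ((1 : G)⁻¹ * h) = (φ : G → Y) h
    rw [inv_one, one_mul]
  mul_smul g k φ := Subtype.ext <| funext fun h => by
    show (φ : G → Y) ((g * k)⁻¹ * h) = (φ : G → Y) (k⁻¹ * (g⁻¹ * h))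
    rw [mul_inv_rev, mul_assoc]

/-- The sectional category of a map: the least `n` such that the base admits a cover by `n`
open sets, each admitting a continuous local section; `∞` if no such finite cover exists. -/
noncomputable def secat {E B : Type*} [TopologicalSpace E] [TopologicalSpace B]
    (p : E → B) : ℕ∞ :=
  ⨅ (n : ℕ) (_ : ∃ U : Fin n → Set B, (∀ i, IsOpen (U i)) ∧ (⋃ i, U i) = Set.univ ∧
      ∀ i, ∃ s : C(U i, E), ∀ b : U i, p (s b) = (b : B)), (n : ℕ∞)

/-- The triple `(X,G;Y)` satisfies the `q`-th Borsuk-Ulam property. -/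
def BorsukUlam (G : Type*) [Group G] (X Y : Type*) [TopologicalSpace X] [TopologicalSpace Y]
    [MulAction G X] (q : ℕ) : Prop :=
  ∀ f : C(X, Y), ∃ (x : X) (S : Finset G), S.card = q ∧ ∃ y : Y, ∀ g ∈ S, f (g • x) = y

/-- The `q`-th index of `(X,G)`: the least `k` such that there is a continuous `G`-equivariant
map `X → Map_q(G, ℝ^{k+1})`; `∞` if no such `k` exists. -/
noncomputable def indexQ (G : Type*) [Group G] (X : Type*) [TopologicalSpace X]
    [MulAction G X] (q : ℕ) : ℕ∞ :=
  ⨅ (k : ℕ) (_ : ∃ Φ : C(X, MapQ G (Fin (k + 1) → ℝ) q),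
      ∀ (g : G) (x : X), Φ (g • x) = g • Φ x), (k : ℕ∞)

namespace ListChain

/-- Prepending `x` to every list of a chain. -/
noncomputable def cons (R : Type*) [CommRing R] {α : Type*} (x : α) :
    (List α →₀ R) →ₗ[R] (List α →₀ R) :=
  Finsupp.lmapDomain R R (List.cons x)

/-- The linear extension of `List.map f`. -/
noncomputable def map (R : Type*) [CommRing R] {α β : Type*} (f : α → β) :
    (List α →₀ R) →ₗ[R] (List β →₀ R) :=
  Finsupp.lmapDomain R R (List.map f)

/-- The augmented simplicial boundary of a list, regarded as an ordered simplex. -/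
noncomputable def listBoundary (R : Type*) [CommRing R] {α : Type*} : List α → (List α →₀ R)
  | [] => 0
  | x :: l => Finsupp.single l 1 - cons R x (listBoundary R l)

/-- The augmented boundary operator on ordered chains. -/
noncomputable def boundary (R : Type*) [CommRing R] (α : Type*) :
    (List α →₀ R) →ₗ[R] (List α →₀ R) :=
  Finsupp.linearCombination R (listBoundary R)

/-- The prism between `f` and `g` over a single list. -/
noncomputable def listPrism (R : Type*) [CommRing R] {α β : Type*} (f g : α → β) :
    List α → (List β →₀ R)
  | [] => 0
  | x :: l => cons R (f x) (Finsupp.single (List.map g (x :: l)) 1)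
      - cons R (f x) (listPrism R f g l)

/-- The prism operator between the chain maps induced by `f` and `g`. -/
noncomputable def prism (R : Type*) [CommRing R] {α β : Type*} (f g : α → β) :
    (List α →₀ R) →ₗ[R] (List β →₀ R) :=
  Finsupp.linearCombination R (listPrism R f g)

section
variable {R : Type*} [CommRing R] {α β : Type*}

@[simp] theorem cons_single (x : α) (l : List α) (r : R) :
    cons R x (Finsupp.single l r) = Finsupp.single (x :: l) r := by
  simp [cons]

@[simp] theorem map_single (f : α → β) (l : List α) (r : R) :
    map R f (Finsupp.single l r) = Finsupp.single (l.map f) r := by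
  simp [map]

@[simp] theorem boundary_single (l : List α) :
    boundary R α (Finsupp.single l 1) = listBoundary R l := by
  simp [boundary]

@[simp] theorem prism_single (f g : α → β) (l : List α) :
    prism R f g (Finsupp.single l 1) = listPrism R f g l := by
  simp [prism]

theorem map_cons (f : α → β) (x : α) (c : List α →₀ R) :
    map R f (cons R x c) = cons R (f x) (map R f c) := by
  suffices h : map R f ∘ₗ cons R x = cons R (f x) ∘ₗ map R f from LinearMap.congr_fun h c
  ext l : 2
  simp

theorem boundary_cons (x : α) (c : List α →₀ R) :
    boundary R α (cons R x c) = c - cons R x (boundary R α c) := by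
  suffices h : boundary R α ∘ₗ cons R x = LinearMap.id - cons R x ∘ₗ boundary R α from
    LinearMap.congr_fun h c
  ext l : 2
  simp [listBoundary]

theorem prism_cons (f g : α → β) (x : α) (c : List α →₀ R) :
    prism R f g (cons R x c)
      = cons R (f x) (map R g (cons R x c)) - cons R (f x) (prism R f g c) := by
  suffices h : prism R f g ∘ₗ cons R x
      = cons R (f x) ∘ₗ map R g ∘ₗ cons R x - cons R (f x) ∘ₗ prism R f g from
    LinearMap.congr_fun h c
  ext l : 2
  simp [listPrism]

theorem boundary_map (f : α → β) (c : List α →₀ R) :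
    boundary R β (map R f c) = map R f (boundary R α c) := by
  suffices h : boundary R β ∘ₗ map R f = map R f ∘ₗ boundary R α from LinearMap.congr_fun h c
  ext l : 2
  simp only [LinearMap.comp_apply, Finsupp.lsingle_apply, map_single, boundary_single]
  induction l with
  | nil => simp [listBoundary]
  | cons x l ih => simp [listBoundary, map_cons, ih]

theorem boundary_prism (f g : α → β) (c : List α →₀ R) :
    boundary R β (prism R f g c) + prism R f g (boundary R α c) = map R g c - map R f c := by
  suffices h : boundary R β ∘ₗ prism R f g + prism R f g ∘ₗ boundary R α = map R g - map R f from
    LinearMap.congr_fun h c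
  ext l : 2
  simp only [LinearMap.comp_apply, LinearMap.add_apply, LinearMap.sub_apply,
    Finsupp.lsingle_apply, map_single, boundary_single, prism_single]
  induction l with
  | nil => simp [listBoundary, listPrism]
  | cons x l ih =>
    have key : boundary R β (listPrism R f g l)
        = Finsupp.single (l.map g) 1 - Finsupp.single (l.map f) 1
          - prism R f g (listBoundary R l) := by rw [← ih]; abel
    simp only [listBoundary, listPrism, map_sub, prism_single, prism_cons, boundary_cons,
      cons_single, List.map_cons, boundary_single, map_cons, key]
    rw [← boundary_single l, ← boundary_map, map_single]
    simp only [boundary_single]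
    abel

end

end ListChain

theorem Finsupp.map_mem_of_mem_supported {R α M : Type*} [CommRing R] [AddCommGroup M] [Module R M]
    {A : Set α} {P : Submodule R M} (F : (α →₀ R) →ₗ[R] M)
    (h : ∀ l ∈ A, F (Finsupp.single l 1) ∈ P) {c : α →₀ R} (hc : c ∈ Finsupp.supported R R A) :
    F c ∈ P := by
  rw [Finsupp.supported_eq_span_single] at hc
  refine (Submodule.span_le (p := P.comap F)).2 ?_ hc
  rintro _ ⟨l, hl, rfl⟩
  exact h l hl

theorem Finsupp.map_eq_of_mem_supported {R α M : Type*} [CommRing R] [AddCommGroup M] [Module R M]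
    {A : Set α} (F F' : (α →₀ R) →ₗ[R] M)
    (h : ∀ l ∈ A, F (Finsupp.single l 1) = F' (Finsupp.single l 1)) {c : α →₀ R}
    (hc : c ∈ Finsupp.supported R R A) : F c = F' c := by
  have : (F - F') c ∈ (⊥ : Submodule R M) :=
    Finsupp.map_mem_of_mem_supported (F - F') (fun l hl => by simp [h l hl]) hc
  simpa [sub_eq_zero] using this

namespace ListChain

section
variable {R : Type*} [CommRing R] {α β : Type*}

theorem listPrism_mem (f g : α → β) (l : List α) :
    listPrism R f g l ∈ Finsupp.supported R R
      {l' | l'.length = l.length + 1 ∧ ∀ z ∈ l', ∃ x ∈ l, z = f x ∨ z = g x} := by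
  induction l with
  | nil => simp [listPrism]
  | cons x l ih =>
    rw [listPrism]
    refine Submodule.sub_mem _ ?_ ?_
    · rw [cons_single]
      refine Finsupp.single_mem_supported _ _ ⟨by simp, ?_⟩
      intro z hz
      rcases List.mem_cons.1 hz with rfl | hz
      · exact ⟨x, by simp, Or.inl rfl⟩
      · obtain ⟨y, hy, rfl⟩ := List.mem_map.1 hz
        exact ⟨y, hy, Or.inr rfl⟩
    · refine Finsupp.map_mem_of_mem_supported (cons R (f x)) ?_ ih
      rintro l' ⟨h1, h2⟩
      rw [cons_single]
      refine Finsupp.single_mem_supported _ _ ⟨by simp [h1], ?_⟩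
      intro z hz
      rcases List.mem_cons.1 hz with rfl | hz
      · exact ⟨x, by simp, Or.inl rfl⟩
      · obtain ⟨y, hy, h⟩ := h2 z hz
        exact ⟨y, by simp [hy], h⟩

/-- Lists of length `k` of points of `K` with pairwise distances below `δ`. -/
def smallLists {E : Type*} [PseudoMetricSpace E] (K : Set E) (δ : ℝ) (k : ℕ) : Set (List E) :=
  {l | l.length = k ∧ (∀ x ∈ l, x ∈ K) ∧ ∀ x ∈ l, ∀ y ∈ l, dist x y < δ}

theorem smallLists_mono {E : Type*} [PseudoMetricSpace E] {K K' : Set E} {δ δ' : ℝ} {k : ℕ}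
    (hK : K ⊆ K') (hδ : δ ≤ δ') : smallLists K δ k ⊆ smallLists K' δ' k :=
  fun _ h => ⟨h.1, fun x hx => hK (h.2.1 x hx), fun x hx y hy => (h.2.2 x hx y hy).trans_le hδ⟩

theorem exists_boundary_eq {E : Type*} [NormedAddCommGroup E] [NormedSpace ℝ E] {K K' : Set E}
    {a : E} {B δ δ' : ℝ} (hδ0 : 0 < δ) (hδ : δ < δ') (ha : a ∈ K')
    (hseg : ∀ x ∈ K, ∀ t ∈ Set.Icc (0 : ℝ) 1, AffineMap.lineMap x a t ∈ K')
    (hB : ∀ x ∈ K, dist x a ≤ B) {k : ℕ} {c : List E →₀ R}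
    (hc : c ∈ Finsupp.supported R R (smallLists K δ k)) (hc0 : boundary R E c = 0) :
    ∃ b ∈ Finsupp.supported R R (smallLists K' δ' (k + 1)), boundary R E b = c := by
  obtain ⟨M, hM⟩ := exists_nat_gt (max 0 (B / (δ' - δ)))
  have hM0 : (0 : ℝ) < M := (le_max_left _ _).trans_lt hM
  have hBM : B / M < δ' - δ := by
    have := (le_max_right _ _).trans_lt hM
    rw [div_lt_iff₀ (by linarith)] at this
    rw [div_lt_iff₀ hM0]; linarith
  let φ : ℕ → E → E := fun j x => AffineMap.lineMap x a ((j : ℝ) / M)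
  have hφ0 : φ 0 = id := by ext x; simp [φ]
  have hφM : φ M = fun _ => a := by ext x; simp [φ, div_self hM0.ne']
  have hφK : ∀ j ≤ M, ∀ x ∈ K, φ j x ∈ K' := fun j hj x hx =>
    hseg x hx _ ⟨by positivity, (div_le_one hM0).2 (by exact_mod_cast hj)⟩
  have hφd : ∀ j ≤ M, ∀ x y, dist (φ j x) (φ j y) ≤ dist x y := by
    intro j hj x y
    have h1 : (j : ℝ) / M ≤ 1 := (div_le_one hM0).2 (by exact_mod_cast hj)
    have h0 : 0 ≤ (j : ℝ) / M := by positivity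
    have : φ j x - φ j y = (1 - (j : ℝ) / M) • (x - y) := by
      simp only [φ, AffineMap.lineMap_apply_module]; module
    rw [dist_eq_norm, dist_eq_norm, this, norm_smul, Real.norm_of_nonneg (by linarith)]
    exact mul_le_of_le_one_left (norm_nonneg _) (by linarith)
  have hφs : ∀ j, ∀ x ∈ K, dist (φ j x) (φ (j + 1) x) ≤ B / M := by
    intro j x hx
    simp only [φ]
    rw [dist_lineMap_lineMap, Real.dist_eq]
    have : |(j : ℝ) / M - ((j + 1 : ℕ) : ℝ) / M| = 1 / M := by
      rw [← sub_div]; push_cast; rw [abs_div, abs_of_pos hM0]; norm_num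
    rw [this, div_mul_eq_mul_div, one_mul]
    gcongr
    exact hB x hx
  have hsum : boundary R E (∑ j ∈ Finset.range M, prism R (φ j) (φ (j + 1)) c)
      = map R (fun _ => a) c - c := by
    rw [map_sum]
    have : ∀ j, boundary R E (prism R (φ j) (φ (j + 1)) c)
        = map R (φ (j + 1)) c - map R (φ j) c := by
      intro j
      rw [← boundary_prism, hc0, map_zero, add_zero]
    simp only [this]
    rw [Finset.sum_range_sub (fun j => map R (φ j) c), hφM, hφ0]
    congr 1
    simp [map]
  refine ⟨cons R a (map R (fun _ => a) c)
    - ∑ j ∈ Finset.range M, prism R (φ j) (φ (j + 1)) c, ?_, ?_⟩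
  · refine Submodule.sub_mem _ ?_ (Submodule.sum_mem _ ?_)
    · refine Finsupp.map_mem_of_mem_supported (cons R a ∘ₗ map R (fun _ => a)) ?_ hc
      rintro l ⟨hl, -, -⟩
      simp only [LinearMap.comp_apply, map_single, cons_single]
      have hz : ∀ z ∈ a :: l.map (fun _ => a), z = a := by simp
      refine Finsupp.single_mem_supported _ _ ⟨by simp [hl], ?_, ?_⟩
      · intro x hx; rw [hz x hx]; exact ha
      · intro x hx y hy; rw [hz x hx, hz y hy, dist_self]; linarith
    · intro j hj
      rw [Finset.mem_range] at hj
      refine Finsupp.map_mem_of_mem_supported (prism R (φ j) (φ (j + 1))) ?_ hc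
      rintro l ⟨hl, hlK, hld⟩
      rw [prism_single]
      refine Finsupp.supported_mono ?_ (listPrism_mem _ _ l)
      rintro l' ⟨h1, h2⟩
      have hd : ∀ x ∈ l, ∀ y ∈ l, dist (φ j x) (φ (j + 1) y) < δ' := by
        intro x hx y hy
        have h1 := hφd j hj.le x y
        have h2 := hφs j y (hlK y hy)
        have h3 := hld x hx y hy
        have h4 := dist_triangle (φ j x) (φ j y) (φ (j + 1) y)
        linarith
      refine ⟨by rw [h1, hl], ?_, ?_⟩
      · intro z hz
        obtain ⟨x, hx, rfl | rfl⟩ := h2 z hz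
        · exact hφK j hj.le x (hlK x hx)
        · exact hφK (j + 1) hj x (hlK x hx)
      · intro z hz w hw
        obtain ⟨x, hx, rfl | rfl⟩ := h2 z hz <;> obtain ⟨y, hy, rfl | rfl⟩ := h2 w hw
        · exact (hφd j hj.le x y).trans_lt ((hld x hx y hy).trans hδ)
        · exact hd x hx y hy
        · rw [dist_comm]; exact hd y hy x hx
        · exact (hφd (j + 1) hj x y).trans_lt ((hld x hx y hy).trans hδ)
  · rw [map_sub, boundary_cons, boundary_map, hc0, map_zero, map_zero, hsum]
    abel

end

end ListChain

/-- The operators of the periodic resolution of a cyclic group of order `p`: the norm element in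
even degrees and `t - 1` in odd degrees. -/
noncomputable def cyclicOp {R A : Type*} [CommRing R] [AddCommGroup A] [Module R A]
    (t : Module.End R A) (p k : ℕ) : Module.End R A :=
  if Even k then ∑ i ∈ Finset.range p, t ^ i else t - 1

section
variable {R A B : Type*} [CommRing R] [AddCommGroup A] [Module R A] [AddCommGroup B] [Module R B]

theorem cyclicOp_succ_mul {t : Module.End R A} {p : ℕ} (ht : t ^ p = 1) (k : ℕ) :
    cyclicOp t p (k + 1) * cyclicOp t p k = 0 := by
  by_cases hk : Even k
  · rw [cyclicOp, if_neg (by simpa [Nat.even_add_one] using hk), cyclicOp, if_pos hk,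
      mul_geom_sum, ht, sub_self]
  · rw [cyclicOp, if_pos (by simpa [Nat.even_add_one] using hk), cyclicOp, if_neg hk,
      geom_sum_mul, ht, sub_self]

theorem pow_mem_of_mem {P : Submodule R A} {t : Module.End R A} (hP : ∀ c ∈ P, t c ∈ P) (i : ℕ) :
    ∀ c ∈ P, (t ^ i) c ∈ P := by
  induction i with
  | zero => simp
  | succ i ih => intro c hc; rw [pow_succ']; exact hP _ (ih c hc)

theorem cyclicOp_mem {P : Submodule R A} {t : Module.End R A} (hP : ∀ c ∈ P, t c ∈ P) (p k : ℕ)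
    {c : A} (hc : c ∈ P) : cyclicOp t p k c ∈ P := by
  rw [cyclicOp]
  split_ifs
  · rw [LinearMap.sum_apply]
    exact Submodule.sum_mem _ fun i _ => pow_mem_of_mem hP i c hc
  · exact Submodule.sub_mem _ (hP c hc) hc

theorem map_cyclicOp {P : Submodule R A} {t : Module.End R A} {t' : Module.End R B}
    (f : A →ₗ[R] B) (hP : ∀ c ∈ P, t c ∈ P) (hf : ∀ c ∈ P, f (t c) = t' (f c)) (p k : ℕ)
    {c : A} (hc : c ∈ P) : f (cyclicOp t p k c) = cyclicOp t' p k (f c) := by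
  have hpow : ∀ i, f ((t ^ i) c) = (t' ^ i) (f c) := by
    intro i
    induction i with
    | zero => simp
    | succ i ih =>
      rw [pow_succ', pow_succ', Module.End.mul_apply, Module.End.mul_apply, ← ih,
        hf _ (pow_mem_of_mem hP i c hc)]
  rw [cyclicOp, cyclicOp]
  split_ifs
  · simp [LinearMap.sum_apply, hpow]
  · simp [hf c hc]

theorem map_cyclicOp' {t : Module.End R A} {t' : Module.End R B}
    (f : A →ₗ[R] B) (hf : ∀ c, f (t c) = t' (f c)) (p k : ℕ) (c : A) :
    f (cyclicOp t p k c) = cyclicOp t' p k (f c) :=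
  map_cyclicOp (P := ⊤) f (by simp) (fun c _ => hf c) p k (by simp)

/-- Over the group ring of a cyclic group of order `p`, the periodic complex built from an
induced module is exact. -/
theorem exists_cyclicOp_eq {t π : Module.End R A} {p : ℕ} (ht : t ^ p = 1) {P : Submodule R A}
    (htP : ∀ c ∈ P, t c ∈ P) (hπP : ∀ c ∈ P, π c ∈ P)
    (hπ : ∀ c ∈ P, ∑ i ∈ Finset.range p, (t ^ i) (π ((t ^ (p - i)) c)) = c) (k : ℕ) {c : A}
    (hc : c ∈ P) (hc0 : cyclicOp t p (k + 1) c = 0) : ∃ b ∈ P, cyclicOp t p k b = c := by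
  by_cases hk : Even k
  · have h1 : t c = c := by
      rw [cyclicOp, if_neg (by simpa [Nat.even_add_one] using hk)] at hc0
      simpa [sub_eq_zero] using hc0
    have h2 : ∀ i, (t ^ i) c = c := fun i => by
      induction i with
      | zero => simp
      | succ i ih => rw [pow_succ', Module.End.mul_apply, ih, h1]
    refine ⟨π c, hπP c hc, ?_⟩
    rw [cyclicOp, if_pos hk, LinearMap.sum_apply]
    simpa only [h2] using hπ c hc
  · rw [cyclicOp, if_pos (by simpa [Nat.even_add_one] using hk), LinearMap.sum_apply] at hc0
    have h0 : ∑ i ∈ Finset.range p, π ((t ^ (p - i)) c) = 0 := by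
      rw [← map_sum]
      convert map_zero π
      rcases p with _ | p
      · simp
      rw [← Finset.sum_range_reflect, ← hc0, Finset.sum_range_succ, Finset.sum_range_succ']
      congr 1
      · refine Finset.sum_congr rfl fun i hi => ?_
        rw [Finset.mem_range] at hi
        congr 2; omega
      · simp [ht]
    refine ⟨∑ i ∈ Finset.range p, (∑ j ∈ Finset.range i, t ^ j) (π ((t ^ (p - i)) c)), ?_, ?_⟩
    · refine Submodule.sum_mem _ fun i _ => ?_
      rw [LinearMap.sum_apply]
      exact Submodule.sum_mem _ fun j _ =>
        pow_mem_of_mem htP _ _ (hπP _ (pow_mem_of_mem htP _ _ hc))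
    · rw [cyclicOp, if_neg hk, map_sum]
      have key : ∀ (i : ℕ) (x : A),
          (t - 1) ((∑ j ∈ Finset.range i, t ^ j) x) = (t ^ i) x - x := fun i x => by
        rw [← Module.End.mul_apply, mul_geom_sum]; simp
      simp only [key, Finset.sum_sub_distrib]
      rw [hπ c hc, h0, sub_zero]

end

namespace ListChain

variable {R : Type*} [CommRing R]

theorem map_pow {α : Type*} (f : α → α) (i : ℕ) :
    ((map R f : Module.End R (List α →₀ R))) ^ i = map R (f^[i]) := by
  induction i with
  | zero => ext l : 2; simp
  | succ i ih =>
    ext l : 2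
    simp [pow_succ', ih, ← Function.iterate_succ']

theorem map_mem_smallLists {E : Type*} [PseudoMetricSpace E] {T : E → E} (hT : Isometry T)
    {K : Set E} (hK : ∀ x ∈ K, T x ∈ K) {δ : ℝ} {k : ℕ} :
    ∀ c ∈ Finsupp.supported R R (smallLists K δ k),
      map R T c ∈ Finsupp.supported R R (smallLists K δ k) := by
  intro c hc
  refine Finsupp.map_mem_of_mem_supported (map R T) ?_ hc
  rintro l ⟨h1, h2, h3⟩
  rw [map_single]
  refine Finsupp.single_mem_supported _ _ ⟨by simpa, ?_, ?_⟩
  · simp only [List.mem_map]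
    rintro _ ⟨x, hx, rfl⟩
    exact hK x (h2 x hx)
  · simp only [List.mem_map]
    rintro _ ⟨x, hx, rfl⟩ _ ⟨y, hy, rfl⟩
    rw [hT.dist_eq]
    exact h3 x hx y hy

/-- A sequence of sets, each of which can be coned off inside the next one, carries arbitrarily
fine chains modelled on the periodic resolution of a cyclic group. -/
theorem exists_chains {E : Type*} [NormedAddCommGroup E] [NormedSpace ℝ E] {T : E → E}
    (hT : Isometry T) {p : ℕ} (hTp : T^[p] = id) (X : ℕ → Set E)
    (hTX : ∀ k, ∀ x ∈ X k, T x ∈ X k) {B : ℝ} (hX0 : (X 0).Nonempty) (K : ℕ)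
    (hcone : ∀ k < K, ∃ a ∈ X (k + 1), ∀ x ∈ X k, dist x a ≤ B ∧
      ∀ t ∈ Set.Icc (0 : ℝ) 1, AffineMap.lineMap x a t ∈ X (k + 1)) {δ : ℝ} (hδ : 0 < δ) :
    ∃ h : ℕ → (List E →₀ R),
      (∀ k ≤ K, h k ∈ Finsupp.supported R R (smallLists (X k) δ (k + 1))) ∧
      boundary R E (h 0) = Finsupp.single [] 1 ∧
      ∀ k < K, boundary R E (h (k + 1)) = cyclicOp (map R T) p (k + 1) (h k) := by
  induction K generalizing δ with
  | zero =>
    obtain ⟨a, ha⟩ := hX0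
    refine ⟨fun _ => Finsupp.single [a] 1, ?_, by simp [listBoundary], by simp⟩
    intro k hk
    obtain rfl : k = 0 := by omega
    exact Finsupp.single_mem_supported _ _ ⟨rfl, by simpa, by simpa⟩
  | succ K ih =>
    obtain ⟨h, h1, h2, h3⟩ := ih (fun k hk => hcone k (by omega)) (half_pos hδ)
    obtain ⟨a, ha, hseg⟩ := hcone K (by omega)
    have hbd : boundary R E (cyclicOp (map R T) p (K + 1) (h K)) = 0 := by
      rw [map_cyclicOp' (t' := map R T) (boundary R E) (fun c => boundary_map T c)]
      rcases K with _ | K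
      · rw [h2, cyclicOp, if_neg (by simp)]
        simp
      · rw [h3 K (by omega), ← Module.End.mul_apply, cyclicOp_succ_mul, LinearMap.zero_apply]
        rw [map_pow, hTp]
        ext l : 2
        simp
    obtain ⟨b, hb, hb'⟩ := exists_boundary_eq (half_pos hδ) (half_lt_self hδ) ha
      (fun x hx => (hseg x hx).2) (fun x hx => (hseg x hx).1)
      (cyclicOp_mem (map_mem_smallLists hT (hTX K)) p (K + 1) (h1 K le_rfl)) hbd
    refine ⟨Function.update h (K + 1) b, ?_, ?_, ?_⟩
    · intro k hk
      rcases hk.eq_or_lt with rfl | hk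
      · simpa using hb
      · rw [Function.update_of_ne (by omega)]
        exact Finsupp.supported_mono (smallLists_mono subset_rfl (by linarith)) (h1 k (by omega))
    · rw [Function.update_of_ne (by omega), h2]
    · intro k hk
      rw [Function.update_of_ne (by omega : k ≠ K + 1)]
      rcases (Nat.lt_succ_iff.1 hk).eq_or_lt with rfl | hk
      · rw [Function.update_self, hb']
      · rw [Function.update_of_ne (by omega), h3 k hk]

end ListChain

namespace ListChain

/-- The augmented boundary of a cell of the iterated join of a discrete set `G`. A cell of the
`m`-fold join is a list of length `m`, whose `i`-th entry is the vertex in the `i`-th join factor,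
if there is one. -/
noncomputable def cellBoundaryAux (R : Type*) [CommRing R] {G : Type*} :
    List (Option G) → (List (Option G) →₀ R)
  | [] => 0
  | none :: l => cons R none (cellBoundaryAux R l)
  | some g :: l => Finsupp.single (none :: l) 1 - cons R (some g) (cellBoundaryAux R l)

/-- The augmented boundary operator of the iterated join of a discrete set `G`. -/
noncomputable def cellBoundary (R : Type*) [CommRing R] (G : Type*) :
    (List (Option G) →₀ R) →ₗ[R] (List (Option G) →₀ R) :=
  Finsupp.linearCombination R (cellBoundaryAux R)

/-- The oriented join of the vertex `g` of the `i`-th factor with a cell. -/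
noncomputable def cellInsertAux (R : Type*) [CommRing R] {G : Type*} (g : G) :
    ℕ → List (Option G) → (List (Option G) →₀ R)
  | _, [] => 0
  | 0, none :: l => Finsupp.single (some g :: l) 1
  | 0, some _ :: _ => 0
  | i + 1, none :: l => cons R none (cellInsertAux R g i l)
  | i + 1, some h :: l => - cons R (some h) (cellInsertAux R g i l)

/-- The oriented join with the vertex `g` of the `i`-th factor. -/
noncomputable def cellInsert (R : Type*) [CommRing R] {G : Type*} (g : G) (i : ℕ) :
    (List (Option G) →₀ R) →ₗ[R] (List (Option G) →₀ R) :=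
  Finsupp.linearCombination R (cellInsertAux R g i)

section
variable {R : Type*} [CommRing R] {G : Type*}

@[simp] theorem cellBoundary_single (l : List (Option G)) :
    cellBoundary R G (Finsupp.single l 1) = cellBoundaryAux R l := by simp [cellBoundary]

@[simp] theorem cellInsert_single (g : G) (i : ℕ) (l : List (Option G)) :
    cellInsert R g i (Finsupp.single l 1) = cellInsertAux R g i l := by simp [cellInsert]

theorem cellBoundary_cons_none (c : List (Option G) →₀ R) :
    cellBoundary R G (cons R none c) = cons R none (cellBoundary R G c) := by
  suffices h : cellBoundary R G ∘ₗ cons R none = cons R none ∘ₗ cellBoundary R G from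
    LinearMap.congr_fun h c
  ext l : 2
  simp [cellBoundaryAux]

theorem cellBoundary_cons_some (g : G) (c : List (Option G) →₀ R) :
    cellBoundary R G (cons R (some g) c)
      = cons R none c - cons R (some g) (cellBoundary R G c) := by
  suffices h : cellBoundary R G ∘ₗ cons R (some g)
      = cons R none - cons R (some g) ∘ₗ cellBoundary R G from LinearMap.congr_fun h c
  ext l : 2
  simp [cellBoundaryAux]

theorem cellInsert_zero_cons_some (g h : G) (c : List (Option G) →₀ R) :
    cellInsert R g 0 (cons R (some h) c) = 0 := by
  suffices h : cellInsert R g 0 ∘ₗ cons R (some h) = 0 from LinearMap.congr_fun h c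
  ext l : 2
  simp [cellInsertAux]

theorem cellInsert_zero_cons_none (g : G) (c : List (Option G) →₀ R) :
    cellInsert R g 0 (cons R none c) = cons R (some g) c := by
  suffices h : cellInsert R g 0 ∘ₗ cons R none = cons R (some g) from LinearMap.congr_fun h c
  ext l : 2
  simp [cellInsertAux]

theorem cellInsert_succ_cons_none (g : G) (i : ℕ) (c : List (Option G) →₀ R) :
    cellInsert R g (i + 1) (cons R none c) = cons R none (cellInsert R g i c) := by
  suffices h : cellInsert R g (i + 1) ∘ₗ cons R none = cons R none ∘ₗ cellInsert R g i from
    LinearMap.congr_fun h c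
  ext l : 2
  simp [cellInsertAux]

theorem cellInsert_succ_cons_some (g h : G) (i : ℕ) (c : List (Option G) →₀ R) :
    cellInsert R g (i + 1) (cons R (some h) c) = - cons R (some h) (cellInsert R g i c) := by
  suffices h : cellInsert R g (i + 1) ∘ₗ cons R (some h)
      = - (cons R (some h) ∘ₗ cellInsert R g i) from LinearMap.congr_fun h c
  ext l : 2
  simp [cellInsertAux]

theorem cellBoundary_cellBoundary (c : List (Option G) →₀ R) :
    cellBoundary R G (cellBoundary R G c) = 0 := by
  suffices h : cellBoundary R G ∘ₗ cellBoundary R G = 0 from LinearMap.congr_fun h c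
  ext l : 2
  simp only [LinearMap.comp_apply, Finsupp.lsingle_apply, cellBoundary_single,
    LinearMap.zero_apply]
  induction l with
  | nil => simp [cellBoundaryAux]
  | cons o l ih =>
    rcases o with _ | g <;>
      simp [cellBoundaryAux, cellBoundary_cons_none, cellBoundary_cons_some, ih]

theorem cellBoundary_map (f : G → G) (c : List (Option G) →₀ R) :
    cellBoundary R G (map R (Option.map f) c) = map R (Option.map f) (cellBoundary R G c) := by
  suffices h : cellBoundary R G ∘ₗ map R (Option.map f)
      = map R (Option.map f) ∘ₗ cellBoundary R G from LinearMap.congr_fun h c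
  ext l : 2
  simp only [LinearMap.comp_apply, Finsupp.lsingle_apply, cellBoundary_single, map_single]
  induction l with
  | nil => simp [cellBoundaryAux]
  | cons o l ih => rcases o with _ | g <;> simp [cellBoundaryAux, map_cons, ih]

theorem cellInsert_map (f : G → G) (g : G) (i : ℕ) (c : List (Option G) →₀ R) :
    cellInsert R (f g) i (map R (Option.map f) c)
      = map R (Option.map f) (cellInsert R g i c) := by
  suffices h : cellInsert R (f g) i ∘ₗ map R (Option.map f)
      = map R (Option.map f) ∘ₗ cellInsert R g i from LinearMap.congr_fun h c
  ext l : 2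
  simp only [LinearMap.comp_apply, Finsupp.lsingle_apply, cellInsert_single, map_single]
  induction l generalizing i with
  | nil => simp [cellInsertAux]
  | cons o l ih => rcases o with _ | g <;> rcases i with _ | i <;> simp [cellInsertAux, map_cons, ih]

theorem cellBoundary_cellInsert (g : G) (i : ℕ) (l : List (Option G)) (hi : i < l.length)
    (hl : ∀ h, l[i]? = some (some h) → h = g) :
    cellBoundary R G (cellInsertAux R g i l)
      = Finsupp.single l 1 - cellInsert R g i (cellBoundaryAux R l) := by
  induction l generalizing i with
  | nil => simp at hi
  | cons o l ih =>
    rcases i with _ | i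
    · rcases o with _ | h
      · simp [cellBoundaryAux, cellInsertAux, cellInsert_zero_cons_none]
      · obtain rfl : h = g := hl h (by simp)
        simp [cellBoundaryAux, cellInsertAux, cellInsert_zero_cons_some]
    · have ih' := ih i (by simpa using hi) (by simpa using hl)
      rcases o with _ | h
      · simp [cellBoundaryAux, cellInsertAux, cellInsert_succ_cons_none, cellBoundary_cons_none,
          ih']
      · simp only [cellInsertAux, map_neg, cellBoundary_cons_some, ih', cellBoundaryAux, map_sub,
          cons_single, cellInsert_succ_cons_some, cellInsert_single]
        abel

theorem cellBoundaryAux_replicate (m : ℕ) :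
    cellBoundaryAux R (List.replicate m (none : Option G)) = 0 := by
  induction m with
  | zero => simp [cellBoundaryAux]
  | succ m ih => simp [List.replicate_succ, cellBoundaryAux, ih]

/-- The cells with `c` vertices in the `m`-fold join. -/
def cells (G : Type*) (m c : ℕ) : Set (List (Option G)) :=
  {l | l.length = m ∧ l.countP Option.isSome = c}

theorem cellBoundaryAux_mem (l : List (Option G)) :
    cellBoundaryAux R l ∈ Finsupp.supported R R
      {l' | l'.length = l.length ∧ l'.countP Option.isSome + 1 = l.countP Option.isSome} := by
  induction l with
  | nil => simp [cellBoundaryAux]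
  | cons o l ih =>
    rcases o with _ | g
    · refine Finsupp.map_mem_of_mem_supported (cons R none) ?_ ih
      rintro l' ⟨h1, h2⟩
      rw [cons_single]
      exact Finsupp.single_mem_supported _ _ ⟨by simp [h1], by simp [h2]⟩
    · refine Submodule.sub_mem _ (Finsupp.single_mem_supported _ _ ⟨by simp, by simp⟩) ?_
      refine Finsupp.map_mem_of_mem_supported (cons R (some g)) ?_ ih
      rintro l' ⟨h1, h2⟩
      rw [cons_single]
      exact Finsupp.single_mem_supported _ _ ⟨by simp [h1], by simp [h2]⟩

theorem cellBoundary_mem {m k : ℕ} {c : List (Option G) →₀ R}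
    (hc : c ∈ Finsupp.supported R R (cells G m (k + 1))) :
    cellBoundary R G c ∈ Finsupp.supported R R (cells G m k) := by
  refine Finsupp.map_mem_of_mem_supported (cellBoundary R G) ?_ hc
  rintro l ⟨h1, h2⟩
  rw [cellBoundary_single]
  refine Finsupp.supported_mono ?_ (cellBoundaryAux_mem l)
  rintro l' ⟨h3, h4⟩
  exact ⟨by omega, by omega⟩

theorem cellInsertAux_mem (g : G) (i : ℕ) (l : List (Option G)) :
    cellInsertAux R g i l ∈ Finsupp.supported R R
      {l' | l'.length = l.length ∧ l'.countP Option.isSome = l.countP Option.isSome + 1 ∧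
        ∀ j h, l'[j]? = some (some h) → l[j]? = some (some h) ∨ (h = g ∧ j = i)} := by
  induction l generalizing i with
  | nil => simp [cellInsertAux]
  | cons o l ih =>
    rcases i with _ | i
    · rcases o with _ | h
      · refine Finsupp.single_mem_supported _ _ ⟨by simp, by simp, ?_⟩
        rintro (_ | j) h hj
        · simp at hj; simp [hj]
        · left; simpa using hj
      · simp [cellInsertAux]
    · have key : cons R o (cellInsertAux R g i l) ∈ Finsupp.supported R R
          {l' | l'.length = (o :: l).length ∧
            l'.countP Option.isSome = (o :: l).countP Option.isSome + 1 ∧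
            ∀ j h, l'[j]? = some (some h) → (o :: l)[j]? = some (some h) ∨ (h = g ∧ j = i + 1)} := by
        refine Finsupp.map_mem_of_mem_supported (cons R o) ?_ (ih i)
        rintro l' ⟨h1, h2, h3⟩
        rw [cons_single]
        refine Finsupp.single_mem_supported _ _ ⟨by simp [h1], ?_, ?_⟩
        · simp only [List.countP_cons, h2]; omega
        · rintro (_ | j) h hj
          · left; simpa using hj
          · simpa using h3 j h (by simpa using hj)
      rcases o with _ | h
      · exact key
      · exact Submodule.neg_mem _ key

/-- The image of an ordered simplex in the `m`-fold join of `G`, under a labelling of its vertices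
by vertices of the join. -/
noncomputable def labelAux (R : Type*) [CommRing R] {α G : Type*} {m : ℕ} (lab : α → G × Fin m) :
    List α → (List (Option G) →₀ R)
  | [] => Finsupp.single (List.replicate m none) 1
  | x :: l => cellInsert R (lab x).1 (lab x).2 (labelAux R lab l)

/-- The map on ordered chains induced by a labelling by vertices of the join. -/
noncomputable def label (R : Type*) [CommRing R] {α G : Type*} {m : ℕ} (lab : α → G × Fin m) :
    (List α →₀ R) →ₗ[R] (List (Option G) →₀ R) :=
  Finsupp.linearCombination R (labelAux R lab)

section
variable {α : Type*} {m : ℕ} {lab : α → G × Fin m}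

@[simp] theorem label_single (l : List α) :
    label R lab (Finsupp.single l 1) = labelAux R lab l := by simp [label]

theorem label_cons (x : α) (c : List α →₀ R) :
    label R lab (cons R x c) = cellInsert R (lab x).1 (lab x).2 (label R lab c) := by
  suffices h : label R lab ∘ₗ cons R x = cellInsert R (lab x).1 (lab x).2 ∘ₗ label R lab from
    LinearMap.congr_fun h c
  ext l : 2
  simp [labelAux]

theorem labelAux_mem (l : List α) :
    labelAux R lab l ∈ Finsupp.supported R R
      {l' | l'.length = m ∧ l'.countP Option.isSome = l.length ∧
        ∀ j h, l'[j]? = some (some h) → ∃ x ∈ l, (lab x).1 = h ∧ ((lab x).2 : ℕ) = j} := by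
  induction l with
  | nil =>
    refine Finsupp.single_mem_supported _ _ ⟨by simp, ?_, ?_⟩
    · simp [List.countP_replicate]
    · intro j h hj
      simp [List.getElem?_replicate] at hj
  | cons x l ih =>
    refine Finsupp.map_mem_of_mem_supported (cellInsert R (lab x).1 (lab x).2) ?_ ih
    rintro l' ⟨h1, h2, h3⟩
    rw [cellInsert_single]
    refine Finsupp.supported_mono ?_ (cellInsertAux_mem _ _ l')
    rintro l'' ⟨h4, h5, h6⟩
    refine ⟨by omega, by simp [h5, h2], ?_⟩
    intro j h hj
    rcases h6 j h hj with h7 | ⟨rfl, rfl⟩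
    · obtain ⟨y, hy, hy'⟩ := h3 j h h7
      exact ⟨y, by simp [hy], hy'⟩
    · exact ⟨x, by simp, rfl, rfl⟩

theorem cellBoundary_labelAux (l : List α)
    (hl : ∀ x ∈ l, ∀ y ∈ l, (lab x).2 = (lab y).2 → (lab x).1 = (lab y).1) :
    cellBoundary R G (labelAux R lab l) = label R lab (listBoundary R l) := by
  induction l with
  | nil =>
    simp only [labelAux, cellBoundary_single, listBoundary, map_zero]
    exact cellBoundaryAux_replicate m
  | cons x l ih =>
    have ih' := ih fun y hy z hz => hl y (by simp [hy]) z (by simp [hz])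
    rw [labelAux, listBoundary, map_sub, label_single, label_cons, ← ih']
    refine Finsupp.map_eq_of_mem_supported
      (cellBoundary R G ∘ₗ cellInsert R (lab x).1 (lab x).2)
      (LinearMap.id - cellInsert R (lab x).1 (lab x).2 ∘ₗ cellBoundary R G) ?_ (labelAux_mem l)
    rintro l' ⟨h1, -, h3⟩
    simp only [LinearMap.comp_apply, LinearMap.sub_apply, LinearMap.id_apply, cellInsert_single,
      cellBoundary_single]
    refine cellBoundary_cellInsert _ _ _ (by rw [h1]; exact (lab x).2.2) ?_
    intro h hh
    obtain ⟨y, hy, rfl, hy'⟩ := h3 _ _ hh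
    exact hl y (by simp [hy]) x (by simp) (Fin.ext hy')

theorem labelAux_map (T : α → α) (f : G → G) (l : List α)
    (hl : ∀ x ∈ l, lab (T x) = (f (lab x).1, (lab x).2)) :
    labelAux R lab (l.map T) = map R (Option.map f) (labelAux R lab l) := by
  induction l with
  | nil => simp [labelAux]
  | cons x l ih =>
    rw [List.map_cons, labelAux, ih fun y hy => hl y (by simp [hy]), hl x (by simp), labelAux,
      cellInsert_map]

end

end

/-- The first vertex of a cell. -/
def firstVertex {p : ℕ} : List (Option (ZMod p)) → ZMod p
  | [] => 0
  | none :: l => firstVertex l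
  | some g :: _ => g

theorem firstVertex_map {p : ℕ} (a : ZMod p) (l : List (Option (ZMod p)))
    (hl : l.countP Option.isSome ≠ 0) :
    firstVertex (l.map (Option.map (· + a))) = firstVertex l + a := by
  induction l with
  | nil => simp at hl
  | cons o l ih =>
    rcases o with _ | g
    · simpa [firstVertex] using ih (by simpa using hl)
    · simp [firstVertex]

end ListChain

namespace ListChain

section
variable {p : ℕ}

/-- The shift of the cells of the iterated join of `ZMod p`. -/
noncomputable def shift (p : ℕ) : Module.End (ZMod p) (List (Option (ZMod p)) →₀ ZMod p) :=
  map (ZMod p) (Option.map (· + 1))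

theorem shift_pow (i : ℕ) : shift p ^ i = map (ZMod p) (Option.map (· + (i : ZMod p))) := by
  rw [shift, map_pow]
  congr 1
  induction i with
  | zero => ext o : 1; simp
  | succ i ih =>
    rw [Function.iterate_succ', ih]
    ext o : 1
    simp [Function.comp_def, add_assoc]

theorem shift_pow_self : shift p ^ p = 1 := by
  rw [shift_pow]
  ext l : 2
  simp

theorem map_optionMap_mem_cells (f : ZMod p → ZMod p) {m c : ℕ} {l : List (Option (ZMod p))}
    (hl : l ∈ cells (ZMod p) m c) : l.map (Option.map f) ∈ cells (ZMod p) m c := by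
  refine ⟨by simpa using hl.1, ?_⟩
  rw [List.countP_map, ← hl.2]
  congr 1
  ext o : 1
  simp

theorem shift_mem {m c : ℕ} : ∀ a ∈ Finsupp.supported (ZMod p) (ZMod p) (cells (ZMod p) m c),
    shift p a ∈ Finsupp.supported (ZMod p) (ZMod p) (cells (ZMod p) m c) := by
  intro a ha
  refine Finsupp.map_mem_of_mem_supported (shift p) (fun l hl => ?_) ha
  rw [shift, map_single]
  exact Finsupp.single_mem_supported _ _ (map_optionMap_mem_cells _ hl)

/-- The projection onto the cells with first vertex `0`. -/
noncomputable def fundamental (p : ℕ) :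
    Module.End (ZMod p) (List (Option (ZMod p)) →₀ ZMod p) :=
  Finsupp.linearCombination (ZMod p)
    fun l => if firstVertex l = 0 then Finsupp.single l 1 else 0

theorem fundamental_single (l : List (Option (ZMod p))) :
    fundamental p (Finsupp.single l 1) = if firstVertex l = 0 then Finsupp.single l 1 else 0 := by
  simp [fundamental]

theorem fundamental_mem {m c : ℕ} :
    ∀ a ∈ Finsupp.supported (ZMod p) (ZMod p) (cells (ZMod p) m c),
      fundamental p a ∈ Finsupp.supported (ZMod p) (ZMod p) (cells (ZMod p) m c) := by
  intro a ha
  refine Finsupp.map_mem_of_mem_supported (fundamental p) (fun l hl => ?_) ha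
  rw [fundamental_single]
  split_ifs
  · exact Finsupp.single_mem_supported _ _ hl
  · exact Submodule.zero_mem _

theorem sum_shift_fundamental [NeZero p] {m c : ℕ} :
    ∀ a ∈ Finsupp.supported (ZMod p) (ZMod p) (cells (ZMod p) m (c + 1)),
      ∑ i ∈ Finset.range p, (shift p ^ i) (fundamental p ((shift p ^ (p - i)) a)) = a := by
  intro a ha
  have := Finsupp.map_eq_of_mem_supported
    (∑ i ∈ Finset.range p, (shift p ^ i) ∘ₗ fundamental p ∘ₗ (shift p ^ (p - i))) LinearMap.id ?_ ha
  · simpa [LinearMap.sum_apply] using this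
  · intro l hl
    have hl0 : l.countP Option.isSome ≠ 0 := by rw [hl.2]; simp
    rw [LinearMap.sum_apply, Finset.sum_eq_single (firstVertex l).val]
    · have hlt : (firstVertex l).val ≤ p := (ZMod.val_lt _).le
      simp only [LinearMap.comp_apply, LinearMap.id_apply]
      rw [shift_pow (p - _), map_single, fundamental_single, firstVertex_map _ _ hl0,
        if_pos (by rw [Nat.cast_sub hlt]; simp), ← map_single, ← shift_pow,
        ← Module.End.mul_apply, ← pow_add, Nat.add_sub_cancel' hlt, shift_pow_self,
        Module.End.one_apply]
    · intro i hi hne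
      rw [Finset.mem_range] at hi
      simp only [LinearMap.comp_apply]
      rw [shift_pow (p - _), map_single, fundamental_single, firstVertex_map _ _ hl0, if_neg,
        map_zero]
      rw [Nat.cast_sub hi.le, CharP.cast_eq_zero, zero_sub, ← sub_eq_add_neg, sub_eq_zero]
      rintro h
      apply hne
      rw [h, ZMod.val_natCast_of_lt hi]
    · intro h
      exact absurd (Finset.mem_range.2 (ZMod.val_lt _)) h

/-- An equivariant labelling by vertices of the `m`-fold join of `ZMod p` cannot be simplicial on
chains modelled on the `m`-skeleton of the periodic resolution. -/
theorem false_of_labelling [NeZero p] (hp1 : p ≠ 1) {E : Type*} {T : E → E} {m : ℕ}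
    {lab : E → ZMod p × Fin m}
    {X : Set E} (hX : ∀ x ∈ X, T x ∈ X)
    (hlab : ∀ x ∈ X, lab (T x) = ((lab x).1 + 1, (lab x).2)) {h : ℕ → (List E →₀ ZMod p)}
    (hh : ∀ k ≤ m, h k ∈ Finsupp.supported (ZMod p) (ZMod p)
      {l | l.length = k + 1 ∧ (∀ x ∈ l, x ∈ X) ∧
        ∀ x ∈ l, ∀ y ∈ l, (lab x).2 = (lab y).2 → (lab x).1 = (lab y).1})
    (h0 : boundary (ZMod p) E (h 0) = Finsupp.single [] 1)
    (hbd : ∀ k < m, boundary (ZMod p) E (h (k + 1))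
      = cyclicOp (map (ZMod p) T) p (k + 1) (h k)) : False := by
  set A : ℕ → Submodule (ZMod p) (List (Option (ZMod p)) →₀ ZMod p) :=
    fun c => Finsupp.supported (ZMod p) (ZMod p) (cells (ZMod p) m c)
  set H : ℕ → (List (Option (ZMod p)) →₀ ZMod p) := fun k => label (ZMod p) lab (h k)
  set D := cellBoundary (ZMod p) (ZMod p)
  have hHA : ∀ k ≤ m, H k ∈ A (k + 1) := by
    intro k hk
    refine Finsupp.map_mem_of_mem_supported (label (ZMod p) lab) ?_ (hh k hk)
    rintro l ⟨h1, -, -⟩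
    rw [label_single]
    refine Finsupp.supported_mono ?_ (labelAux_mem l)
    rintro l' ⟨h3, h4, -⟩
    exact ⟨h3, by rw [h4, h1]⟩
  have hDH : ∀ k ≤ m, D (H k) = label (ZMod p) lab (boundary (ZMod p) E (h k)) := by
    intro k hk
    refine Finsupp.map_eq_of_mem_supported (D ∘ₗ label (ZMod p) lab)
      (label (ZMod p) lab ∘ₗ boundary (ZMod p) E) ?_ (hh k hk)
    rintro l ⟨-, -, h1⟩
    simp only [LinearMap.comp_apply, label_single, boundary_single]
    exact cellBoundary_labelAux l h1
  have hDH0 : D (H 0) = Finsupp.single (List.replicate m none) 1 := by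
    rw [hDH 0 (Nat.zero_le _), h0, label_single, labelAux]
  have hDH' : ∀ k < m, D (H (k + 1)) = cyclicOp (shift p) p (k + 1) (H k) := by
    intro k hk
    rw [hDH (k + 1) hk, hbd k hk]
    refine map_cyclicOp (label (ZMod p) lab) ?_ ?_ p (k + 1) (hh k hk.le)
    · intro c hc
      refine Finsupp.map_mem_of_mem_supported (map (ZMod p) T) ?_ hc
      rintro l ⟨h1, h2, h3⟩
      rw [map_single]
      refine Finsupp.single_mem_supported _ _ ⟨by simpa, ?_, ?_⟩
      · simp only [List.mem_map]
        rintro _ ⟨x, hx, rfl⟩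
        exact hX x (h2 x hx)
      · simp only [List.mem_map]
        rintro _ ⟨x, hx, rfl⟩ _ ⟨y, hy, rfl⟩
        rw [hlab x (h2 x hx), hlab y (h2 y hy)]
        intro hxy
        rw [h3 x hx y hy hxy]
    · intro c hc
      refine Finsupp.map_eq_of_mem_supported (label (ZMod p) lab ∘ₗ map (ZMod p) T)
        (shift p ∘ₗ label (ZMod p) lab) ?_ hc
      rintro l ⟨-, h2, -⟩
      simp only [LinearMap.comp_apply, map_single, label_single]
      exact labelAux_map T (· + 1) l fun x hx => hlab x (h2 x hx)
  have hDt : ∀ k c, D (cyclicOp (shift p) p k c) = cyclicOp (shift p) p k (D c) := fun k c =>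
    map_cyclicOp' D (fun c => cellBoundary_map (· + 1) c) p k c
  have hHm : H m = 0 := by
    have : cells (ZMod p) m (m + 1) = ∅ := by
      ext l
      simp only [cells, Set.mem_ofPred_eq, Set.mem_empty_iff_false, iff_false, not_and]
      intro h1 h2
      have := List.countP_le_length (p := Option.isSome) (l := l)
      omega
    have h2 := hHA m le_rfl
    simp only [A, this, Finsupp.supported_empty, Submodule.mem_bot] at h2
    exact h2
  have key : ∀ d j, j + d = m →
      ∃ z ∈ A (j + 2), ∃ z' ∈ A (j + 1), H j = D z + cyclicOp (shift p) p j z' := by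
    intro d
    induction d with
    | zero =>
      rintro j rfl
      exact ⟨0, Submodule.zero_mem _, 0, Submodule.zero_mem _, by simpa using hHm⟩
    | succ d ih =>
      intro j hj
      obtain ⟨z, hz, z', hz', hHz⟩ := ih (j + 1) (by omega)
      have h1 : cyclicOp (shift p) p (j + 1) (H j - D z') = 0 := by
        rw [map_sub, ← hDH' j (by omega), hHz, map_add, cellBoundary_cellBoundary, hDt, zero_add,
          sub_self]
      obtain ⟨b, hb, hb'⟩ := exists_cyclicOp_eq shift_pow_self shift_mem fundamental_mem
        sum_shift_fundamental j
        (Submodule.sub_mem _ (hHA j (by omega)) (cellBoundary_mem hz')) h1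
      exact ⟨z', hz', b, hb, by rw [hb']; abel⟩
  obtain ⟨z, -, z', hz', hH0⟩ := key m 0 (by omega)
  have h1 : D (H 0) = cyclicOp (shift p) p 0 (D z') := by
    rw [hH0, map_add, cellBoundary_cellBoundary, hDt, zero_add]
  have h2 : cyclicOp (shift p) p 0 (D z') = 0 := by
    have hDz : D z' ∈ A 0 := cellBoundary_mem hz'
    refine Finsupp.map_eq_of_mem_supported (cyclicOp (shift p) p 0) 0 ?_ hDz
    rintro l ⟨-, h3⟩
    have h4 : ∀ a : ZMod p, l.map (Option.map (· + a)) = l := by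
      intro a
      rw [List.countP_eq_zero] at h3
      conv_rhs => rw [← List.map_id l]
      refine List.map_congr_left fun o ho => ?_
      have := h3 o ho
      rcases o with _ | g
      · rfl
      · simp at this
    rw [cyclicOp, if_pos (by simp), LinearMap.sum_apply]
    simp [shift_pow, h4]
  rw [hDH0, h2, Finsupp.single_eq_zero] at h1
  have : Nontrivial (ZMod p) := ZMod.nontrivial_iff.2 hp1
  exact one_ne_zero h1

end

end ListChain

/-- A family of disjoint open sets permuted simply transitively by `G`: equivalently, an
equivariant continuous `G`-valued function on an invariant open set. -/
structure IsColouring {G X : Type*} [Group G] [MulAction G X] [TopologicalSpace X]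
    (O : G → Set X) : Prop where
  isOpen : ∀ g, IsOpen (O g)
  eq_of_mem : ∀ {g h x}, x ∈ O g → x ∈ O h → g = h
  smul_mem_iff : ∀ {k g x}, k • x ∈ O (k * g) ↔ x ∈ O g

namespace IsColouring

variable {G X : Type*} [Group G] [MulAction G X] [TopologicalSpace X]

/-- The colouring defined by a local section of the quotient map of a free action. -/
theorem of_section [Finite G] [T2Space X] [ContinuousConstSMul G X]
    (hfree : ∀ (g : G) (x : X), g • x = x → g = 1)
    {U : Set (Quotient (MulAction.orbitRel G X))} (hU : IsOpen U) (s : C(U, X))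
    (hs : ∀ b : U, Quotient.mk _ (s b) = (b : Quotient (MulAction.orbitRel G X))) :
    IsColouring fun g : G => {x : X | ∃ h : Quotient.mk _ x ∈ U, g • s ⟨_, h⟩ = x} := by
  have huniq : ∀ {g h : G} {x : X}, g • x = h • x → g = h := fun {g h x} hgh => by
    refine (inv_mul_eq_one.1 (hfree (h⁻¹ * g) x ?_)).symm
    rw [mul_smul, hgh, inv_smul_smul]
  refine ⟨fun g => ?_, fun {g h x} => ?_, fun {k g x} => ?_⟩
  · have hA : IsOpen {x : X | Quotient.mk (MulAction.orbitRel G X) x ∈ U} :=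
      hU.preimage continuous_quotient_mk'
    set A := {x : X | Quotient.mk (MulAction.orbitRel G X) x ∈ U}
    set f : A → X := fun y => s ⟨Quotient.mk _ (y : X), y.2⟩
    have hf : Continuous f := s.continuous.comp
      (Continuous.subtype_mk (continuous_quotient_mk'.comp continuous_subtype_val) _)
    have hopen : IsOpen {y : A | g • f y = y} := by
      have : {y : A | g • f y = y} = (⋃ h : {h : G // h ≠ g}, {y : A | h.1 • f y = y})ᶜ := by
        ext y
        simp only [Set.mem_ofPred_eq, Set.mem_compl_iff, Set.mem_iUnion, Subtype.exists,
          exists_prop, not_exists, not_and]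
        refine ⟨fun h k hk hky => hk (huniq (hky.trans h.symm)), fun h => ?_⟩
        obtain ⟨k, hk⟩ := Quotient.exact (hs ⟨_, y.2⟩).symm
        by_contra hg
        exact h k (fun hkg => hg (hkg ▸ hk)) hk
      rw [this, isOpen_compl_iff]
      exact isClosed_iUnion_of_finite fun h =>
        isClosed_eq (hf.const_smul _) continuous_subtype_val
    convert hA.isOpenMap_subtype_val _ hopen using 1
    ext x
    constructor
    · rintro ⟨h, hx⟩
      exact ⟨⟨x, h⟩, hx, rfl⟩
    · rintro ⟨y, hy, rfl⟩
      exact ⟨y.2, hy⟩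
  · rintro ⟨_, h1⟩ ⟨_, h2⟩
    exact huniq (h1.trans h2.symm)
  · have hkx : (Quotient.mk (MulAction.orbitRel G X) (k • x)) = Quotient.mk _ x :=
      Quotient.sound ⟨k, rfl⟩
    simp only [Set.mem_ofPred_eq, hkx, mul_smul, smul_left_cancel_iff]

/-- If finitely many colourings cover `X`, then the sectional category of the quotient map is
bounded by their number. -/
theorem secat_le [ContinuousConstSMul G X] {ι : Type*} [Fintype ι] {O : ι → G → Set X}
    (hO : ∀ i, IsColouring (O i)) (hcov : ∀ x, ∃ i g, x ∈ O i g) :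
    secat (Quotient.mk (MulAction.orbitRel G X)) ≤ (Fintype.card ι : ℕ∞) := by
  have hπ : IsOpenMap (Quotient.mk (MulAction.orbitRel G X)) := isOpenMap_quotient_mk'_mul
  let e := Fintype.equivFin ι
  refine iInf₂_le (Fintype.card ι) ⟨fun i => Quotient.mk _ '' O (e.symm i) 1, fun i => ?_, ?_,
    fun i => ?_⟩
  · exact hπ _ ((hO _).isOpen 1)
  · refine Set.eq_univ_of_forall fun b => ?_
    obtain ⟨x, rfl⟩ := Quotient.exists_rep b
    obtain ⟨i, g, hx⟩ := hcov x
    refine Set.mem_iUnion.2 ⟨e i, g⁻¹ • x, ?_, Quotient.sound ⟨g⁻¹, rfl⟩⟩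
    rw [e.symm_apply_apply, ← (hO i).smul_mem_iff (k := g)]
    simpa using hx
  · choose s hs hs' using fun b : (Quotient.mk (MulAction.orbitRel G X) '' O (e.symm i) 1) => b.2
    refine ⟨⟨s, continuous_def.2 fun V hV => ?_⟩, hs'⟩
    refine isOpen_induced_iff.2 ⟨_, hπ _ (hV.inter ((hO (e.symm i)).isOpen 1)), ?_⟩
    ext b
    constructor
    · rintro ⟨x, ⟨hxV, hx⟩, hxb⟩
      obtain ⟨k, hk⟩ := Quotient.exact (hxb.trans (hs' b).symm)
      have h1 := (hO (e.symm i)).smul_mem_iff (k := k).2 (hs b)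
      rw [show k • s b = x from hk] at h1
      have hk1 : k = 1 := by simpa using (hO _).eq_of_mem h1 hx
      rw [Set.mem_preimage, show s b = x by simpa [hk1] using hk]
      exact hxV
    · exact fun hb => ⟨s b, ⟨hb, hs b⟩, hs' b⟩

end IsColouring

/-- A family of disjoint open sets of functions on `ZMod p` permuted by translations. -/
structure IsTranslationColouring {p : ℕ} {Y : Type*} [TopologicalSpace Y]
    (O : ZMod p → Set (ZMod p → Y)) : Prop where
  isOpen : ∀ g, IsOpen (O g)
  eq_of_mem : ∀ {g h x}, x ∈ O g → x ∈ O h → g = h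
  translate_mem_iff : ∀ {h g x}, (fun a => x (a - h)) ∈ O (g + h) ↔ x ∈ O g

/-- The mean of a finite subset of `ZMod p`, meaningful if `p` does not divide its size. -/
def zmodMean {p : ℕ} (S : Finset (ZMod p)) : ZMod p := (∑ a ∈ S, a) * (S.card : ZMod p)⁻¹

theorem zmod_natCast_ne_zero {p s : ℕ} (hs0 : 0 < s) (hsp : s < p) : (s : ZMod p) ≠ 0 := by
  rw [Ne, ZMod.natCast_eq_zero_iff]
  exact Nat.not_dvd_of_pos_of_lt hs0 hsp

theorem zmodMean_map_addRight {p : ℕ} [Fact p.Prime] {S : Finset (ZMod p)} (hs0 : 0 < S.card)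
    (hsp : S.card < p) (h : ZMod p) :
    zmodMean (S.map (Equiv.addRight h).toEmbedding) = zmodMean S + h := by
  have := zmod_natCast_ne_zero hs0 hsp
  simp only [zmodMean, Finset.sum_map, Finset.card_map, Equiv.coe_toEmbedding,
    Equiv.coe_addRight, Finset.sum_add_distrib, Finset.sum_const, nsmul_eq_mul]
  field_simp

namespace IsTranslationColouring

variable {p : ℕ} {Y : Type*} [TopologicalSpace Y]

/-- A colouring obtained from combinatorial patterns carrying an equivariant invariant `ν`. -/
theorem of_pattern {Γ : Type*} (σ : ZMod p → Equiv.Perm Γ) {P : Γ → Prop}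
    {W : Γ → Set (ZMod p → Y)} {ν : Γ → ZMod p} (hP : ∀ h γ, P (σ h γ) ↔ P γ)
    (hW : ∀ γ, IsOpen (W γ)) (hWσ : ∀ h γ x, (fun a => x (a - h)) ∈ W (σ h γ) ↔ x ∈ W γ)
    (hν : ∀ h γ, P γ → ν (σ h γ) = ν γ + h)
    (huniq : ∀ γ γ' x, P γ → P γ' → x ∈ W γ → x ∈ W γ' → γ = γ') :
    IsTranslationColouring fun g => {x | ∃ γ, P γ ∧ ν γ = g ∧ x ∈ W γ} := by
  refine ⟨fun g => ?_, ?_, fun {h g x} => ?_⟩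
  · simp only [Set.ofPred_exists, Set.ofPred_and]
    exact isOpen_iUnion fun γ => isOpen_const.inter (isOpen_const.inter (hW γ))
  · rintro g h x ⟨γ, h1, rfl, h2⟩ ⟨γ', h3, rfl, h4⟩
    rw [huniq γ γ' x h1 h3 h2 h4]
  · refine ((σ h).exists_congr fun γ => ?_).symm
    rw [hP, hWσ]
    exact and_congr_right fun hγ => by rw [hν h γ hγ, add_left_inj]

theorem of_finset [Fact p.Prime] {s : ℕ} (hs0 : 0 < s) (hsp : s < p)
    {W : Finset (ZMod p) → Set (ZMod p → Y)} (hW : ∀ S, IsOpen (W S))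
    (hWσ : ∀ h S x, (fun a => x (a - h)) ∈ W (S.map (Equiv.addRight h).toEmbedding) ↔ x ∈ W S)
    (huniq : ∀ S S' x, S.card = s → S'.card = s → x ∈ W S → x ∈ W S' → S ⊆ S') :
    IsTranslationColouring fun g => {x | ∃ S, S.card = s ∧ zmodMean S = g ∧ x ∈ W S} :=
  of_pattern (fun h => (Equiv.addRight h).finsetCongr) (by simp) hW hWσ
    (by
      rintro h S rfl
      exact zmodMean_map_addRight hs0 hsp h)
    fun S S' x h1 h2 h3 h4 => (huniq S S' x h1 h2 h3 h4).antisymm (huniq S' S x h2 h1 h4 h3)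

end IsTranslationColouring

section patterns

variable {p : ℕ} {Y : Type*}

/-- Functions whose values on `S` lie below the values outside `S`. -/
def lowerPattern [LT Y] (S : Finset (ZMod p)) : Set (ZMod p → Y) :=
  {x | ∀ a ∈ S, ∀ b ∉ S, x a < x b}

/-- Functions whose values on `S` are closer to each other than to the values outside `S`. -/
def clusterPattern [Dist Y] (S : Finset (ZMod p)) : Set (ZMod p → Y) :=
  {x | ∀ a ∈ S, ∀ b ∈ S, ∀ c ∉ S, dist (x a) (x b) < dist (x a) (x c)}

/-- Functions for which distances within classes of `r` are less than distances of inequivalent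
points. -/
def setoidPattern [Dist Y] (r : Setoid (ZMod p)) : Set (ZMod p → Y) :=
  {x | ∀ a b a' b', r a b → ¬ r a' b' → dist (x a) (x b) < dist (x a') (x b')}

theorem exists_mem_notMem_of_card_eq {α : Type*} {S S' : Finset α} (h : S.card = S'.card) {a : α}
    (ha : a ∈ S) (ha' : a ∉ S') : ∃ b ∈ S', b ∉ S := by
  by_contra! hle
  exact ha' (Finset.eq_of_subset_of_card_le hle h.le ▸ ha)

theorem isOpen_lowerPattern [NeZero p] [TopologicalSpace Y] [LinearOrder Y]
    [OrderClosedTopology Y] (S : Finset (ZMod p)) : IsOpen (lowerPattern (Y := Y) S) := by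
  simp only [lowerPattern, Set.ofPred_forall]
  exact isOpen_iInter_of_finite fun a => isOpen_iInter_of_finite fun _ =>
    isOpen_iInter_of_finite fun b => isOpen_iInter_of_finite fun _ =>
      isOpen_lt (by fun_prop) (by fun_prop)

theorem isTranslationColouring_lower [Fact p.Prime] {s : ℕ} (hs0 : 0 < s) (hsp : s < p)
    {n : ℕ} (j : Fin n) :
    IsTranslationColouring fun g => {x : ZMod p → Fin n → ℝ | ∃ S, S.card = s ∧ zmodMean S = g ∧
      x ∈ {x | (fun a => x a j) ∈ lowerPattern S}} := by
  refine .of_finset hs0 hsp (fun S => ?_) (fun h S x => ?_) (fun S S' x h1 h2 h3 h4 => ?_)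
  · exact (isOpen_lowerPattern S).preimage
      (f := fun (x : ZMod p → Fin n → ℝ) a => x a j) (by fun_prop)
  · constructor
    · intro H a ha b hb
      simpa using H (a + h) (by simpa using ha) (b + h) (by simpa using hb)
    · intro H a ha b hb
      exact H _ (by simpa [Finset.mem_map_equiv, sub_eq_add_neg] using ha) _
        (by simpa [Finset.mem_map_equiv, sub_eq_add_neg] using hb)
  · intro a ha
    by_contra ha'
    obtain ⟨b, hb, hb'⟩ := exists_mem_notMem_of_card_eq (h1.trans h2.symm) ha ha'
    exact lt_asymm (h3 a ha b hb') (h4 b hb a ha')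

theorem isTranslationColouring_cluster [Fact p.Prime] [PseudoMetricSpace Y] {s : ℕ}
    (hs : p < 2 * s) (hsp : s < p) :
    IsTranslationColouring fun g => {x : ZMod p → Y | ∃ S, S.card = s ∧ zmodMean S = g ∧
      x ∈ clusterPattern S} := by
  refine .of_finset (by omega) hsp (fun S => ?_) (fun h S x => ?_) (fun S S' x h1 h2 h3 h4 => ?_)
  · simp only [clusterPattern, Set.ofPred_forall]
    exact isOpen_iInter_of_finite fun a => isOpen_iInter_of_finite fun _ =>
      isOpen_iInter_of_finite fun b => isOpen_iInter_of_finite fun _ =>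
        isOpen_iInter_of_finite fun c => isOpen_iInter_of_finite fun _ =>
          isOpen_lt (by fun_prop) (by fun_prop)
  · constructor
    · intro H a ha b hb c hc
      simpa using H (a + h) (by simpa using ha) (b + h) (by simpa using hb) (c + h)
        (by simpa using hc)
    · intro H a ha b hb c hc
      exact H _ (by simpa [Finset.mem_map_equiv, sub_eq_add_neg] using ha) _
        (by simpa [Finset.mem_map_equiv, sub_eq_add_neg] using hb) _
        (by simpa [Finset.mem_map_equiv, sub_eq_add_neg] using hc)
  · obtain ⟨z, hz⟩ : (S ∩ S').Nonempty := by
      rw [← Finset.card_pos]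
      have := Finset.card_union_add_card_inter S S'
      have := (S ∪ S').card_le_univ
      rw [ZMod.card] at this
      omega
    obtain ⟨hz, hz'⟩ := Finset.mem_inter.1 hz
    intro a ha
    by_contra ha'
    obtain ⟨b, hb, hb'⟩ := exists_mem_notMem_of_card_eq (h1.trans h2.symm) ha ha'
    exact lt_asymm (h3 z hz a ha b hb')
      (h4 z hz' b hb a ha')

/-- The translate of an equivalence relation. -/
def translateSetoid (h : ZMod p) : Equiv.Perm (Setoid (ZMod p)) where
  toFun := Setoid.comap (· - h)
  invFun := Setoid.comap (· + h)
  left_inv r := by ext a b; simp [Setoid.comap_rel]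
  right_inv r := by ext a b; simp [Setoid.comap_rel]

theorem translateSetoid_apply {h : ZMod p} {r : Setoid (ZMod p)} {a b : ZMod p} :
    translateSetoid h r a b ↔ r (a - h) (b - h) := Iff.rfl

/-- Translation by `h` identifies the classes of `translateSetoid h r` with those of `r`. -/
def translateSetoidEquiv (h : ZMod p) (r : Setoid (ZMod p)) :
    Quotient (translateSetoid h r) ≃ Quotient r :=
  Quotient.congr (Equiv.subRight h) fun _ _ => Iff.rfl

open Classical in
/-- The mean of the means of the classes of `r`. -/
noncomputable def setoidMean [NeZero p] (r : Setoid (ZMod p)) : ZMod p :=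
  (∑ c : Quotient r, zmodMean (Finset.univ.filter fun a => Quotient.mk r a = c)) *
    (Nat.card (Quotient r) : ZMod p)⁻¹

theorem setoidMean_translateSetoid [Fact p.Prime] {r : Setoid (ZMod p)}
    (hr : 1 < Nat.card (Quotient r)) (hr' : Nat.card (Quotient r) < p) (h : ZMod p) :
    setoidMean (translateSetoid h r) = setoidMean r + h := by
  classical
  have hc : ∀ c : Quotient r,
      zmodMean (Finset.univ.filter fun a =>
        Quotient.mk (translateSetoid h r) a = (translateSetoidEquiv h r).symm c)
      = zmodMean (Finset.univ.filter fun a => Quotient.mk r a = c) + h := by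
    intro c
    obtain ⟨a, rfl⟩ := Quotient.exists_rep c
    rw [← zmodMean_map_addRight]
    · congr 1
      ext b
      simp only [Finset.mem_filter, Finset.mem_univ, true_and, Finset.mem_map_equiv,
        Equiv.eq_symm_apply]
      simp only [Equiv.addRight_symm, Equiv.coe_addRight, ← sub_eq_add_neg]
      rfl
    · exact Finset.card_pos.2 ⟨a, by simp⟩
    · have := Finite.one_lt_card_iff_nontrivial.1 hr
      obtain ⟨d, hd⟩ := exists_ne (Quotient.mk r a)
      obtain ⟨b, rfl⟩ := Quotient.exists_rep d
      exact (Finset.card_lt_univ_of_notMem (x := b) (by simpa using hd)).trans_eq (ZMod.card p)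
  have hk := zmod_natCast_ne_zero (zero_lt_one.trans hr) hr'
  unfold setoidMean
  rw [Nat.card_congr (translateSetoidEquiv h r), ← (translateSetoidEquiv h r).symm.sum_comp]
  simp only [hc, Finset.sum_add_distrib, Finset.sum_const, Finset.card_univ, nsmul_eq_mul,
    ← Nat.card_eq_fintype_card]
  field_simp

theorem setoid_eq_of_le_of_card_eq [NeZero p] {r r' : Setoid (ZMod p)} (hle : r ≤ r')
    (hcard : Nat.card (Quotient r) = Nat.card (Quotient r')) : r = r' := by
  refine le_antisymm hle fun a b hab => ?_
  have hsurj : Function.Surjective (Quotient.map (sa := r) (sb := r') id hle) := fun c => by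
    obtain ⟨a, rfl⟩ := Quotient.exists_rep c
    exact ⟨Quotient.mk r a, rfl⟩
  exact Quotient.exact ((hsurj.bijective_of_nat_card_le hcard.le).1
    (a₁ := Quotient.mk r a) (a₂ := Quotient.mk r b) (Quotient.sound hab))

theorem isTranslationColouring_setoid [Fact p.Prime] [PseudoMetricSpace Y] {k : ℕ}
    (hk : 1 < k) (hkp : k < p) :
    IsTranslationColouring fun g => {x : ZMod p → Y | ∃ r, Nat.card (Quotient r) = k ∧
      setoidMean r = g ∧ x ∈ setoidPattern r} := by
  refine .of_pattern translateSetoid (fun h r => ?_) (fun r => ?_) (fun h r x => ?_) ?_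
    fun r r' x h1 h2 h3 h4 => ?_
  · rw [Nat.card_congr (translateSetoidEquiv h r)]
  · simp only [setoidPattern, Set.ofPred_forall]
    exact isOpen_iInter_of_finite fun a => isOpen_iInter_of_finite fun b =>
      isOpen_iInter_of_finite fun a' => isOpen_iInter_of_finite fun b' =>
        isOpen_iInter_of_finite fun _ => isOpen_iInter_of_finite fun _ =>
          isOpen_lt (by fun_prop) (by fun_prop)
  · constructor
    · intro H a b a' b' h1 h2
      simpa using H (a + h) (b + h) (a' + h) (b' + h)
        (by simpa [translateSetoid_apply] using h1)
        (by simpa [translateSetoid_apply] using h2)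
    · exact fun H a b a' b' h1 h2 => H _ _ _ _ h1 h2
  · rintro h r rfl
    exact setoidMean_translateSetoid hk hkp h
  · by_cases hle : r ≤ r'
    · exact setoid_eq_of_le_of_card_eq hle (h1.trans h2.symm)
    · refine (setoid_eq_of_le_of_card_eq (fun a b hab => ?_) (h2.trans h1.symm)).symm
      obtain ⟨c, d, hcd, hcd'⟩ : ∃ c d, r c d ∧ ¬ r' c d := by
        simpa [Setoid.le_def] using hle
      by_contra hab'
      exact lt_asymm (h3 c d a b hcd hab') (h4 a b c d hab hcd')

end patterns

/-- The nonconstant functions outside `Map_q` are covered by `p - q` colourings. -/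
theorem exists_colouring_compl_mapQ {p q : ℕ} [Fact p.Prime] {Y : Type*} [MetricSpace Y]
    (hq2 : 2 ≤ q) (hcase : q = 2 ∨ p < 2 * q) :
    ∃ O : Fin (p - q) → ZMod p → Set (ZMod p → Y), (∀ i, IsTranslationColouring (O i)) ∧
      ∀ x, (∃ a b, x a ≠ x b) → x ∉ MapQ (ZMod p) Y q → ∃ i g, x ∈ O i g := by
  classical
  rcases hcase with rfl | hpq
  · refine ⟨_, fun i => isTranslationColouring_setoid (k := i + 2) (by omega) (by omega), ?_⟩
    rintro x ⟨a, b, hab⟩ hx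
    have h1 : 1 < Nat.card (Quotient (Setoid.ker x)) :=
      Finite.one_lt_card_iff_nontrivial.2 ⟨Quotient.mk _ a, Quotient.mk _ b,
        fun h => hab (Quotient.exact h)⟩
    have h2 : Nat.card (Quotient (Setoid.ker x)) < p := by
      simp only [MapQ, Set.mem_ofPred_eq, not_forall, not_not] at hx
      obtain ⟨S, hS, y, hy⟩ := hx
      obtain ⟨c, d, hcd, rfl⟩ := Finset.card_eq_two.1 hS
      by_contra! hle
      have hinj := (Quotient.mk_surjective (s := Setoid.ker x)).bijective_of_nat_card_le
        (by simpa using hle)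
      exact hcd (hinj.1 (Quotient.sound ((hy c (by simp)).trans (hy d (by simp)).symm)))
    refine ⟨⟨Nat.card (Quotient (Setoid.ker x)) - 2, by omega⟩, _, Setoid.ker x,
      by simp only; omega, rfl, fun c d c' d' h h' => ?_⟩
    rw [show x c = x d from h, dist_self]
    exact dist_pos.2 h'
  · refine ⟨_, fun i => isTranslationColouring_cluster (s := i + q) (by omega) (by omega), ?_⟩
    rintro x ⟨a, b, hab⟩ hx
    simp only [MapQ, Set.mem_ofPred_eq, not_forall, not_not] at hx
    obtain ⟨S, hS, y, hy⟩ := hx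
    set S' := Finset.univ.filter fun c => x c = y
    have h1 : q ≤ S'.card := hS ▸ Finset.card_le_card fun c hc => by simpa [S'] using hy c hc
    have h2 : S'.card < p := by
      refine (Finset.card_lt_card (Finset.filter_ssubset.2 ?_)).trans_eq (ZMod.card p)
      by_contra! h
      exact hab ((h a (Finset.mem_univ a)).trans (h b (Finset.mem_univ b)).symm)
    refine ⟨⟨S'.card - q, by omega⟩, _, S', by simp only; omega, rfl, fun c hc d hd e he => ?_⟩
    simp only [S', Finset.mem_filter, Finset.mem_univ, true_and] at hc hd he
    rw [hc, hd, dist_self]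
    exact dist_pos.2 (Ne.symm he)

namespace CyclicFunction

variable {p : ℕ}

/-- The cyclic translation of functions on `ZMod p`. -/
def rotate {Y : Type*} (x : ZMod p → Y) : ZMod p → Y := fun a => x (a - 1)

theorem rotate_add_one {Y : Type*} (x : ZMod p → Y) : rotate (fun a => x (a + 1)) = x := by
  funext a
  simp [rotate]

theorem rotate_iterate {Y : Type*} (x : ZMod p → Y) (k : ℕ) :
    rotate^[k] x = fun a => x (a - k) := by
  induction k with
  | zero => simp
  | succ k ih =>
    rw [Function.iterate_succ_apply', ih]
    funext a
    simp only [rotate]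
    congr 1
    push_cast
    ring

theorem isometry_rotate [NeZero p] {Y : Type*} [PseudoMetricSpace Y] :
    Isometry (rotate : (ZMod p → Y) → ZMod p → Y) := by
  convert (IsometryEquiv.piCongrLeft' (Y := fun _ => Y) (Equiv.addRight (1 : ZMod p))).isometry
    using 1
  funext x a
  simp [rotate, sub_eq_add_neg]

/-- Points of the geometric join of `n` copies of the `(p - 2)`-skeleton of a simplex. -/
def joinSpace (p n : ℕ) [NeZero p] : Set (ZMod p → Fin n → ℝ) :=
  {x | (∀ a j, 0 ≤ x a j) ∧ ∑ a, ∑ j, x a j = 1 ∧ ∀ j, ∃ a, x a j = 0}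

theorem mem_Icc_of_mem_joinSpace {n : ℕ} [NeZero p] {x : ZMod p → Fin n → ℝ}
    (hx : x ∈ joinSpace p n) (a : ZMod p) (j : Fin n) : x a j ∈ Set.Icc (0 : ℝ) 1 := by
  refine ⟨hx.1 a j, ?_⟩
  calc x a j ≤ ∑ j, x a j := Finset.single_le_sum (fun j _ => hx.1 a j) (Finset.mem_univ j)
    _ ≤ ∑ a, ∑ j, x a j := Finset.single_le_sum (f := fun a => ∑ j, x a j)
        (fun a _ => Finset.sum_nonneg fun j _ => hx.1 a j) (Finset.mem_univ a)
    _ = 1 := hx.2.1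

theorem isCompact_joinSpace (p n : ℕ) [NeZero p] : IsCompact (joinSpace p n) := by
  refine (isCompact_Icc (a := (0 : ZMod p → Fin n → ℝ)) (b := 1)).of_isClosed_subset ?_ ?_
  · simp only [joinSpace, Set.ofPred_and, Set.ofPred_forall, Set.ofPred_exists]
    refine (isClosed_iInter fun a => isClosed_iInter fun j => ?_).inter
      (IsClosed.inter ?_ (isClosed_iInter fun j => isClosed_iUnion_of_finite fun a => ?_))
    · exact isClosed_le (by fun_prop) (by fun_prop)
    · exact isClosed_eq (by fun_prop) (by fun_prop)
    · exact isClosed_eq (by fun_prop) (by fun_prop)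
  · exact fun x hx => ⟨fun a j => (mem_Icc_of_mem_joinSpace hx a j).1,
      fun a j => (mem_Icc_of_mem_joinSpace hx a j).2⟩

theorem rotate_mem_joinSpace {n : ℕ} [NeZero p] {x : ZMod p → Fin n → ℝ}
    (hx : x ∈ joinSpace p n) : rotate x ∈ joinSpace p n := by
  refine ⟨fun a j => hx.1 _ j, ?_, fun j => ?_⟩
  · rw [← hx.2.1]
    exact (Equiv.subRight (1 : ZMod p)).sum_comp fun a => ∑ j, x a j
  · obtain ⟨a, ha⟩ := hx.2.2 j
    exact ⟨a + 1, by simpa [rotate] using ha⟩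

theorem exists_ne_of_mem_joinSpace {n : ℕ} [NeZero p] {x : ZMod p → Fin n → ℝ}
    (hx : x ∈ joinSpace p n) : ∃ a b, x a ≠ x b := by
  by_contra! h
  have h0 : ∀ a j, x a j = 0 := fun a j => by
    obtain ⟨b, hb⟩ := hx.2.2 j
    rw [h a b, hb]
  simpa [h0] using hx.2.1

/-- The `k`-skeleton of `joinSpace p n` on which the join factors are filled in order. -/
def skeleton (p n : ℕ) [NeZero p] (k : ℕ) : Set (ZMod p → Fin n → ℝ) :=
  {x | (∀ a j, 0 ≤ x a j) ∧ ∑ a, ∑ j, x a j = 1 ∧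
    ∀ j, (Finset.univ.filter fun a => x a j ≠ 0).card ≤ min (p - 1) (k + 1 - (p - 1) * j)}

theorem skeleton_subset_joinSpace {p n : ℕ} [NeZero p] (k : ℕ) :
    skeleton p n k ⊆ joinSpace p n := by
  rintro x ⟨h0, h1, h2⟩
  refine ⟨h0, h1, fun j => ?_⟩
  by_contra! h
  have := h2 j
  rw [Finset.filter_true_of_mem fun a _ => h a, Finset.card_univ, ZMod.card] at this
  have := NeZero.pos p
  omega

theorem rotate_mem_skeleton {n k : ℕ} [NeZero p] {x : ZMod p → Fin n → ℝ}
    (hx : x ∈ skeleton p n k) : rotate x ∈ skeleton p n k := by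
  refine ⟨fun a j => hx.1 _ j, ?_, fun j => ?_⟩
  · rw [← hx.2.1]
    exact (Equiv.subRight (1 : ZMod p)).sum_comp fun a => ∑ j, x a j
  · refine le_trans (le_of_eq ?_) (hx.2.2 j)
    refine Finset.card_bij (fun a _ => a - 1) (fun a ha => ?_) (by simp) fun b hb =>
      ⟨b + 1, ?_, by simp⟩
    · exact Finset.mem_filter.2 ⟨Finset.mem_univ _, (Finset.mem_filter.1 ha).2⟩
    · exact Finset.mem_filter.2 ⟨Finset.mem_univ _,
        by simpa [rotate] using (Finset.mem_filter.1 hb).2⟩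

/-- The vertex of the join indexed by `0` in the `j`-th factor. -/
def vertex (p : ℕ) {n : ℕ} (j : Fin n) : ZMod p → Fin n → ℝ :=
  Pi.single 0 (Pi.single j 1)

theorem vertex_apply {n : ℕ} (j : Fin n) (a : ZMod p) (i : Fin n) :
    vertex p j a i = if a = 0 ∧ i = j then 1 else 0 := by
  unfold vertex
  by_cases ha : a = 0
  · subst ha
    simp [Pi.single_apply]
  · simp [ha]

theorem sum_vertex [NeZero p] {n : ℕ} (j : Fin n) : ∑ a, ∑ i, vertex p j a i = 1 := by
  simp [vertex_apply, ite_and]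

theorem lineMap_vertex_mem_skeleton [NeZero p] (hp1 : 1 < p) {n k : ℕ} {j : Fin n}
    (hj : (k + 1) / (p - 1) = j) {x : ZMod p → Fin n → ℝ} (hx : x ∈ skeleton p n k) {t : ℝ}
    (ht : t ∈ Set.Icc (0 : ℝ) 1) :
    AffineMap.lineMap x (vertex p j) t ∈ skeleton p n (k + 1) := by
  have happ : ∀ a i, AffineMap.lineMap x (vertex p j) t a i
      = (1 - t) * x a i + t * vertex p j a i := fun a i => by
    simp [AffineMap.lineMap_apply_module]
  refine ⟨fun a i => ?_, ?_, fun i => ?_⟩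
  · rw [happ, vertex_apply]
    have := mul_nonneg (sub_nonneg.2 ht.2) (hx.1 a i)
    have := ht.1
    split_ifs <;> linarith
  · simp_rw [happ, Finset.sum_add_distrib, ← Finset.mul_sum]
    rw [hx.2.1, sum_vertex]
    ring
  · have hi := hx.2.2 i
    have hmod := Nat.div_add_mod (k + 1) (p - 1)
    have hlt := Nat.mod_lt (k + 1) (show p - 1 > 0 by omega)
    by_cases hij : i = j
    · subst hij
      rw [hj] at hmod
      have hsub : (Finset.univ.filter fun a => AffineMap.lineMap x (vertex p i) t a i ≠ 0)
          ⊆ insert 0 (Finset.univ.filter fun a => x a i ≠ 0) := by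
        intro a
        simp only [Finset.mem_filter, Finset.mem_univ, true_and, Finset.mem_insert, happ,
          vertex_apply]
        intro h
        by_contra! h'
        simp [h'] at h
      have := (Finset.card_le_card hsub).trans (Finset.card_insert_le _ _)
      omega
    · refine (Finset.card_le_card ?_).trans (hi.trans ?_)
      · intro a
        simp only [Finset.mem_filter, Finset.mem_univ, true_and, happ, vertex_apply, hij]
        intro h h'
        simp [h'] at h
      · exact min_le_min_left _ (by omega)

theorem vertex_mem_skeleton [NeZero p] (hp1 : 1 < p) {n : ℕ} {j : Fin n} (hj : (j : ℕ) = 0) :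
    vertex p j ∈ skeleton p n 0 := by
  refine ⟨fun a i => ?_, sum_vertex j, fun i => ?_⟩
  · rw [vertex_apply]
    split_ifs <;> norm_num
  · by_cases hij : i = j
    · subst hij
      refine (Finset.card_le_one.2 fun a ha b hb => ?_).trans (by rw [hj]; omega)
      simp only [Finset.mem_filter, vertex_apply, ne_eq, ite_eq_right_iff, not_forall] at ha hb
      exact ha.2.1.1.trans hb.2.1.1.symm
    · simp [vertex_apply, hij]

theorem dist_le_one_of_mem_joinSpace {n : ℕ} [NeZero p] {x y : ZMod p → Fin n → ℝ}
    (hx : x ∈ joinSpace p n) (hy : y ∈ joinSpace p n) : dist x y ≤ 1 :=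
  (dist_pi_le_iff zero_le_one).2 fun a => (dist_pi_le_iff zero_le_one).2 fun j =>
    Real.dist_le_of_mem_Icc_01 (mem_Icc_of_mem_joinSpace hx a j) (mem_Icc_of_mem_joinSpace hy a j)

theorem skeleton_mono {n : ℕ} [NeZero p] : Monotone (skeleton p n) :=
  fun _ _ hk _ hx => ⟨hx.1, hx.2.1, fun j => (hx.2.2 j).trans (min_le_min_left _ (by omega))⟩

/-- A labelling of `joinSpace p n` subordinate to an equivariant open cover and compatible with
the cyclic translation. -/
theorem exists_labelling [NeZero p] {n : ℕ} {ι : Type*} [Nonempty ι]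
    (O : ι → ZMod p → Set (ZMod p → Fin n → ℝ)) (hopen : ∀ i g, IsOpen (O i g))
    (hdisj : ∀ i g h x, x ∈ O i g → x ∈ O i h → g = h)
    (hrot : ∀ i g x, rotate x ∈ O i (g + 1) ↔ x ∈ O i g)
    (hcov : ∀ x ∈ joinSpace p n, ∃ i g, x ∈ O i g) :
    ∃ δ > 0, ∃ lab : (ZMod p → Fin n → ℝ) → ZMod p × ι,
      (∀ x ∈ joinSpace p n, lab (rotate x) = ((lab x).1 + 1, (lab x).2)) ∧
      ∀ x ∈ joinSpace p n, ∀ y ∈ joinSpace p n, dist x y < δ →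
        (lab x).2 = (lab y).2 → (lab x).1 = (lab y).1 := by
  classical
  obtain ⟨δ, hδ, hball⟩ := lebesgue_number_lemma_of_metric
    (c := fun i : ι × ZMod p => O i.1 i.2) (isCompact_joinSpace p n) (fun i => hopen _ _)
    (fun x hx => by
      obtain ⟨i, g, h⟩ := hcov x hx
      exact Set.mem_iUnion.2 ⟨(i, g), h⟩)
  set I : (ZMod p → Fin n → ℝ) → Set ι := fun x => {i | ∃ g, Metric.ball x δ ⊆ O i g}
  have hI : ∀ x ∈ joinSpace p n, (I x).Nonempty := fun x hx => by
    obtain ⟨i, hi⟩ := hball x hx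
    exact ⟨i.1, i.2, hi⟩
  have hIrot : ∀ x, I (rotate x) = I x := fun x => by
    ext i
    constructor
    · rintro ⟨g, hg⟩
      refine ⟨g - 1, fun y hy => ?_⟩
      rw [← hrot, sub_add_cancel]
      exact hg (by rwa [Metric.mem_ball, isometry_rotate.dist_eq])
    · rintro ⟨g, hg⟩
      refine ⟨g + 1, fun y hy => ?_⟩
      rw [← rotate_add_one y, Metric.mem_ball, isometry_rotate.dist_eq] at hy
      rw [← rotate_add_one y, hrot]
      exact hg hy
  set c : Set ι → ι := fun S => Classical.epsilon fun i => i ∈ S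
  set d : ι → (ZMod p → Fin n → ℝ) → ZMod p := fun i x => Classical.epsilon fun g => x ∈ O i g
  have hc : ∀ x ∈ joinSpace p n, ∃ g, Metric.ball x δ ⊆ O (c (I x)) g := fun x hx =>
    Classical.epsilon_spec (p := fun i => i ∈ I x) (hI x hx)
  have hd : ∀ i g x, x ∈ O i g → d i x = g := fun i g x hx =>
    hdisj i _ _ x (Classical.epsilon_spec (p := fun g => x ∈ O i g) ⟨g, hx⟩) hx
  refine ⟨δ, hδ, fun x => (d (c (I x)) x, c (I x)), fun x hx => ?_, fun x hx y hy hxy h => ?_⟩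
  · obtain ⟨g, hg⟩ := hc x hx
    have hxg := hg (Metric.mem_ball_self hδ)
    simp only [hIrot, hd _ _ _ hxg, hd _ _ _ ((hrot _ _ _).2 hxg)]
  · simp only at h ⊢
    obtain ⟨g, hg⟩ := hc x hx
    rw [← h, hd _ _ _ (hg (Metric.mem_ball_self hδ)),
      hd _ _ _ (hg (by rwa [Metric.mem_ball, dist_comm]))]

/-- A Borsuk-Ulam theorem: nonconstant functions `ZMod p → ℝⁿ` admit no cover by fewer than
`n (p - 1)` colourings. -/
theorem le_card_of_cover [Fact p.Prime] {n : ℕ} (hn : 1 ≤ n) {ι : Type*} [Fintype ι]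
    (O : ι → ZMod p → Set (ZMod p → Fin n → ℝ)) (hO : ∀ i, IsTranslationColouring (O i))
    (hcov : ∀ x : ZMod p → Fin n → ℝ, (∃ a b, x a ≠ x b) → ∃ i g, x ∈ O i g) :
    n * (p - 1) ≤ Fintype.card ι := by
  by_contra! hlt
  have hp1 : 1 < p := (Fact.out : p.Prime).one_lt
  have hv := vertex_mem_skeleton hp1 (j := (⟨0, hn⟩ : Fin n)) rfl
  have hcov' : ∀ x ∈ joinSpace p n, ∃ i g, x ∈ O i g := fun x hx =>
    hcov x (exists_ne_of_mem_joinSpace hx)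
  obtain ⟨i₀, -⟩ := hcov' _ (skeleton_subset_joinSpace 0 hv)
  have : Nonempty ι := ⟨i₀⟩
  obtain ⟨δ, hδ, lab, hlab, hlab'⟩ := exists_labelling O (fun i => (hO i).isOpen)
    (fun i _ _ _ => (hO i).eq_of_mem) (fun i _ _ => (hO i).translate_mem_iff) hcov'
  obtain ⟨h, hh, h0, hbd⟩ := ListChain.exists_chains (R := ZMod p) (B := 1)
    (isometry_rotate (p := p) (Y := Fin n → ℝ))
    (p := p) (by funext x; rw [rotate_iterate]; simp) (skeleton p n)
    (fun k x hx => rotate_mem_skeleton hx) ⟨_, hv⟩ (Fintype.card ι) (fun k hk => by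
      have hj : (k + 1) / (p - 1) < n := (Nat.div_lt_iff_lt_mul (by omega)).2 (by omega)
      have hcone := fun x hx t ht => lineMap_vertex_mem_skeleton (p := p) (n := n) (k := k) hp1
        (j := ⟨_, hj⟩) rfl (x := x) hx (t := t) ht
      have hmem : vertex p ⟨_, hj⟩ ∈ skeleton p n (k + 1) := by
        simpa using hcone _ (skeleton_mono (Nat.zero_le k) hv) 1 (by simp)
      exact ⟨_, hmem, fun x hx => ⟨dist_le_one_of_mem_joinSpace (skeleton_subset_joinSpace _ hx)
        (skeleton_subset_joinSpace _ hmem), hcone x hx⟩⟩) hδ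
  have e := Fintype.equivFin ι
  refine ListChain.false_of_labelling hp1.ne' (T := rotate) (X := joinSpace p n)
    (lab := fun x => ((lab x).1, e (lab x).2)) (fun x hx => rotate_mem_joinSpace hx)
    (fun x hx => by simp [hlab x hx]) (fun k hk => ?_) h0 hbd
  refine Finsupp.supported_mono ?_ (hh k hk)
  rintro l ⟨h1, h2, h3⟩
  have h4 := fun x hx => skeleton_subset_joinSpace k (h2 x hx)
  exact ⟨h1, h4, fun x hx y hy hxy =>
    hlab' x (h4 x hx) y (h4 y hy) (h3 x hx y hy) (e.injective hxy)⟩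

end CyclicFunction

theorem MapQ.eq_one_of_smul_eq {p q : ℕ} {Y : Type*} [Fact p.Prime] (hqp : q ≤ p) (g : Multiplicative (ZMod p))
    (φ : MapQ (Multiplicative (ZMod p)) Y q) (hg : g • φ = φ) : g = 1 := by
  by_contra hg1
  obtain ⟨S, -, hS⟩ := Finset.exists_subset_card_eq
    (s := (Finset.univ : Finset (Multiplicative (ZMod p)))) (n := q)
    (by rw [Finset.card_univ, Fintype.card_multiplicative, ZMod.card]; exact hqp)
  refine φ.2 S hS ⟨φ.1 1, fun a _ => ?_⟩
  have hcard : Nat.card (Multiplicative (ZMod p)) = p := by simp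
  obtain ⟨k, rfl⟩ := mem_powers_of_prime_card (g' := a) hcard hg1
  have hk : ∀ k : ℕ, g ^ k • φ = φ := fun k => by
    induction k with
    | zero => simp
    | succ k ih => rw [pow_succ, mul_smul, hg, ih]
  have : φ.1 ((g ^ k)⁻¹ * g ^ k) = φ.1 (g ^ k) :=
    congrFun (congrArg Subtype.val (hk k)) (g ^ k)
  rw [← this, inv_mul_cancel]

section transfer

variable {p q : ℕ} {Y : Type*} [TopologicalSpace Y]

instance MapQ.instContinuousConstSMul {G : Type*} [Group G] :
    ContinuousConstSMul G (MapQ G Y q) :=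
  ⟨fun g => Continuous.subtype_mk
    (f := fun φ : MapQ G Y q => fun h => (φ : G → Y) (g⁻¹ * h))
    (continuous_pi fun _ => (continuous_apply _).comp continuous_subtype_val) _⟩

theorem MapQ.isOpen {G : Type*} [Finite G] [T2Space Y] (hq : 0 < q) : IsOpen (MapQ G Y q) := by
  have : MapQ G Y q = ⋂ S : Finset G, ⋂ _ : S.card = q, ⋃ a ∈ S, ⋃ b ∈ S, {x | x a ≠ x b} := by
    ext x
    simp only [MapQ, Set.mem_ofPred_eq, Set.mem_iInter, Set.mem_iUnion, exists_prop]
    refine forall₂_congr fun S hS => ⟨fun h => ?_, ?_⟩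
    · obtain ⟨a, ha⟩ := Finset.card_pos.1 (hS ▸ hq)
      by_contra! h'
      exact h ⟨x a, fun b hb => h' b hb a ha⟩
    · rintro ⟨a, ha, b, hb, hab⟩ ⟨y, hy⟩
      exact hab ((hy a ha).trans (hy b hb).symm)
  rw [this]
  exact isOpen_iInter_of_finite fun S => isOpen_iInter_of_finite fun _ => isOpen_biUnion fun a _ =>
    isOpen_biUnion fun b _ => isOpen_ne_fun (by fun_prop) (by fun_prop)

theorem IsColouring.isTranslationColouring [NeZero p] [T2Space Y] (hq : 0 < q)
    {O : Multiplicative (ZMod p) → Set (MapQ (Multiplicative (ZMod p)) Y q)}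
    (hO : IsColouring O) :
    IsTranslationColouring fun g => {x : ZMod p → Y |
      ∃ φ ∈ O (Multiplicative.ofAdd g), φ.1 = fun a => x a.toAdd} := by
  refine ⟨fun g => ?_, ?_, fun {h g x} => ⟨?_, ?_⟩⟩
  · exact ((MapQ.isOpen hq).isOpenMap_subtype_val _ (hO.isOpen _)).preimage
      (f := fun (x : ZMod p → Y) (a : Multiplicative (ZMod p)) => x a.toAdd) (by fun_prop)
  · rintro g h x ⟨φ, hφ, hx⟩ ⟨ψ, hψ, hx'⟩
    obtain rfl : φ = ψ := Subtype.ext (hx.trans hx'.symm)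
    exact Multiplicative.ofAdd.injective (hO.eq_of_mem hφ hψ)
  · rintro ⟨φ, hφ, hx⟩
    refine ⟨(Multiplicative.ofAdd h)⁻¹ • φ, ?_, ?_⟩
    · rw [← hO.smul_mem_iff (k := Multiplicative.ofAdd h), smul_inv_smul, ← ofAdd_add, add_comm]
      exact hφ
    · funext a
      refine (congrFun hx (((Multiplicative.ofAdd h)⁻¹)⁻¹ * a)).trans ?_
      simp
  · rintro ⟨φ, hφ, hx⟩
    refine ⟨Multiplicative.ofAdd h • φ, ?_, ?_⟩
    · rw [add_comm, ofAdd_add, hO.smul_mem_iff]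
      exact hφ
    · funext a
      refine (congrFun hx ((Multiplicative.ofAdd h)⁻¹ * a)).trans ?_
      simp [neg_add_eq_sub]

theorem IsTranslationColouring.isColouring {O : ZMod p → Set (ZMod p → Y)}
    (hO : IsTranslationColouring O) :
    IsColouring fun g : Multiplicative (ZMod p) =>
      {φ : MapQ (Multiplicative (ZMod p)) Y q | (fun a => φ.1 (Multiplicative.ofAdd a)) ∈
        O g.toAdd} := by
  refine ⟨fun g => ?_, fun h h' => Multiplicative.toAdd.injective (hO.eq_of_mem h h'),
    fun {k g φ} => ?_⟩
  · exact (hO.isOpen _).preimage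
      (f := fun (φ : MapQ (Multiplicative (ZMod p)) Y q) a => φ.1 (Multiplicative.ofAdd a))
      (continuous_pi fun _ => (continuous_apply _).comp continuous_subtype_val)
  · have hk : (fun a => (k • φ).1 (Multiplicative.ofAdd a)) =
        fun a => φ.1 (Multiplicative.ofAdd (a - k.toAdd)) := by
      funext a
      rw [sub_eq_neg_add]
      rfl
    rw [Set.mem_ofPred_eq, Set.mem_ofPred_eq, hk, toAdd_mul, add_comm]
    exact hO.translate_mem_iff (x := fun a => φ.1 (Multiplicative.ofAdd a))

end transfer

/-- The values of a finite real family attaining the minimum. -/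
theorem exists_mem_lowerPattern {p : ℕ} [NeZero p] (y : ZMod p → ℝ) :
    ∃ S : Finset (ZMod p), S.Nonempty ∧ y ∈ lowerPattern S ∧ ∀ a ∈ S, ∀ b ∈ S, y a = y b := by
  obtain ⟨a, ha⟩ := Finite.exists_min y
  refine ⟨Finset.univ.filter fun b => y b = y a, ⟨a, by simp⟩, fun b hb c hc => ?_,
    fun b hb c hc => ?_⟩
  · simp only [Finset.mem_filter, Finset.mem_univ, true_and] at hb hc
    exact hb ▸ (ha c).lt_of_ne (Ne.symm hc)
  · simp only [Finset.mem_filter, Finset.mem_univ, true_and] at hb hc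
    rw [hb, hc]

theorem exists_colouring_mapQ {p q m : ℕ} [Fact p.Prime] (hqp : q ≤ p) :
    ∃ O : (Fin m × Fin (p - 1)) ⊕ Fin (q - 1) → ZMod p → Set (ZMod p → Fin (m + 1) → ℝ),
      (∀ i, IsTranslationColouring (O i)) ∧
      ∀ x ∈ MapQ (ZMod p) (Fin (m + 1) → ℝ) q, ∃ i g, x ∈ O i g := by
  refine ⟨Sum.elim _ _, Sum.rec
    (fun i => isTranslationColouring_lower (s := i.2 + 1) (by omega) (by omega) i.1.castSucc)
    (fun i => isTranslationColouring_lower (s := i + 1) (by omega) (by omega) (Fin.last m)),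
    fun x hx => ?_⟩
  by_cases h : ∃ j : Fin m, ∃ a b, x a j.castSucc ≠ x b j.castSucc
  · obtain ⟨j, a, b, hab⟩ := h
    obtain ⟨S, hS, hxS, hconst⟩ := exists_mem_lowerPattern fun a => x a j.castSucc
    have hlt : S.card < p := by
      refine lt_of_lt_of_eq (Finset.card_lt_card
        (Finset.ssubset_univ_iff.2 fun hSu => ?_)) (ZMod.card p)
      exact hab (hconst a (by simp [hSu]) b (by simp [hSu]))
    have := hS.card_pos
    exact ⟨.inl (j, ⟨S.card - 1, by omega⟩), _, S, by simp only; omega, rfl, hxS⟩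
  · push Not at h
    obtain ⟨S, hS, hxS, hconst⟩ := exists_mem_lowerPattern fun a => x a (Fin.last m)
    have hlt : S.card < q := by
      by_contra! hle
      obtain ⟨S', hS', hcard⟩ := Finset.exists_subset_card_eq hle
      obtain ⟨a, ha⟩ := hS
      refine hx S' hcard ⟨x a, fun b hb => funext fun j => ?_⟩
      induction j using Fin.lastCases with
      | last => exact hconst b (hS' hb) a ha
      | cast j => exact h j b a
    have := hS.card_pos
    exact ⟨.inr ⟨S.card - 1, by omega⟩, _, S, by simp only; omega, rfl, hxS⟩

/-- If `q = 2` or `2q > p`, then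
`secat(Map_q(ℤ_p, ℝⁿ) → Map_q(ℤ_p, ℝⁿ)/ℤ_p) = (n-1)(p-1) + q - 1`. -/
theorem statement_7 (p q n : ℕ) (hp : p.Prime) (hq2 : 2 ≤ q) (hqp : q ≤ p) (hn : 1 ≤ n)
    (hcase : q = 2 ∨ p < 2 * q) :
    secat (Quotient.mk (MulAction.orbitRel (Multiplicative (ZMod p))
        (MapQ (Multiplicative (ZMod p)) (Fin n → ℝ) q)))
      = (((n - 1) * (p - 1) + q - 1 : ℕ) : ℕ∞) := by
  obtain ⟨m, rfl⟩ : ∃ m, n = m + 1 := ⟨n - 1, by omega⟩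
  have : Fact p.Prime := ⟨hp⟩
  refine le_antisymm ?_ (le_iInf₂ fun d hd => ?_)
  · obtain ⟨O, hO, hcov⟩ := exists_colouring_mapQ (m := m) hqp
    refine (IsColouring.secat_le (fun i => (hO i).isColouring) fun φ => ?_).trans_eq ?_
    · exact hcov _ φ.2
    · congr 1
      simp only [Fintype.card_sum, Fintype.card_prod, Fintype.card_fin, Nat.add_sub_cancel]
      omega
  · obtain ⟨U, hU, hUcov, hs⟩ := hd
    choose s hs using hs
    obtain ⟨O, hO, hcov⟩ := exists_colouring_compl_mapQ (p := p) (Y := Fin (m + 1) → ℝ) hq2 hcase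
    have hC := fun i => (IsColouring.of_section (MapQ.eq_one_of_smul_eq hqp) (hU i) (s i)
      (hs i)).isTranslationColouring (by omega)
    have hsum := CyclicFunction.le_card_of_cover (ι := Fin d ⊕ Fin (p - q)) (hn := hn)
      (Sum.elim _ O) (Sum.rec hC hO) fun x hx => ?_
    · rw [Fintype.card_sum, Fintype.card_fin, Fintype.card_fin, Nat.succ_mul] at hsum
      rw [Nat.cast_le, Nat.add_sub_cancel]
      have := hp.two_le
      omega
    · by_cases hxq : x ∈ MapQ (ZMod p) (Fin (m + 1) → ℝ) q
      · let φ : MapQ (Multiplicative (ZMod p)) (Fin (m + 1) → ℝ) q := ⟨fun a => x a.toAdd, hxq⟩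
        obtain ⟨i, hi⟩ := Set.mem_iUnion.1 (hUcov.symm ▸ Set.mem_univ
          (Quotient.mk (MulAction.orbitRel (Multiplicative (ZMod p)) _) φ))
        obtain ⟨g, hg⟩ := Quotient.exact (hs i ⟨_, hi⟩).symm
        exact ⟨.inl i, g.toAdd, φ, ⟨hi, hg⟩, rfl⟩
      · obtain ⟨i, g, h⟩ := hcov x hx hxq
        exact ⟨.inr i, g, h⟩
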